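/- arXiv:alg-geom/9710020 — 2 statements merged into one kernel-verified Lean document; each statement's English description precedes it below -/
import Mathlib

section
/- Let X and Y be birational smooth projective n-dimensional algebraic varieties over ℂ with trivial canonical line bundles. Then there exist Zariski open dense subsets U ⊂ X and V ⊂ Y such that U is isomorphic to V, the codimension of X∖U in X is at least 2, and the codimension of Y∖V in Y is at least 2. -/
/-!
STATEMENT 4: Let X and Y be birational smooth projective n-dimensional algebraic
varieties over ℂ with trivial canonical line bundles. Then there exist Zariski open
dense subsets U ⊂ X and V ⊂ Y such that U is isomorphic to V and the complements
X∖U and Y∖V have codimension ≥ 2 in X resp. Y.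
-/

open AlgebraicGeometry CategoryTheory Opposite

universe u

attribute [local instance] MvPolynomial.gradedAlgebra

noncomputable section

namespace BirGeo

/-- Transfer of (exterior-algebra valued) differential forms along a morphism of
`R`-algebras `A → B`: the natural map `⋀ Ω[A⁄R] → ⋀ Ω[B⁄R]` induced by
functoriality of Kähler differentials. -/
noncomputable def formTransfer (R A B : Type u) [CommRing R] [CommRing A] [CommRing B]
    [Algebra R A] [Algebra R B] [Algebra A B] [IsScalarTower R A B] :
    ExteriorAlgebra A (Ω[A⁄R]) → ExteriorAlgebra B (Ω[B⁄R]) :=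
  letI : Algebra A (ExteriorAlgebra B (Ω[B⁄R])) :=
    Algebra.compHom (ExteriorAlgebra B (Ω[B⁄R])) (algebraMap A B)
  letI : @IsScalarTower A B (ExteriorAlgebra B (Ω[B⁄R])) _ Algebra.toSMul Algebra.toSMul :=
    IsScalarTower.of_algebraMap_eq' rfl
  fun w =>
    ExteriorAlgebra.lift A
      ⟨(LinearMap.restrictScalars A
          (ExteriorAlgebra.ι B (M := Ω[B⁄R]))).comp (KaehlerDifferential.map R R A B),
        fun m => by
          simp [ExteriorAlgebra.ι_sq_zero (R := B) ((KaehlerDifferential.map R R A B) m)]⟩ w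

variable (k : CommRingCat.{u}) (X : Scheme.{u}) [X.Over (Spec k)]

/-- The canonical ring homomorphism from the base ring `k` to the ring of sections
over an open `U` of a scheme `X` over `Spec k`. -/
noncomputable def secHom (U : X.Opens) : ↥k →+* ↥Γ(X, U) :=
  ((Scheme.ΓSpecIso k).inv ≫ (X ↘ Spec k).appTop ≫ X.presheaf.map (homOfLE le_top).op : k ⟶ Γ(X, U)).hom

/-- The `k`-algebra structure on sections of a scheme over `Spec k`. -/
noncomputable def secAlgebra (U : X.Opens) : Algebra ↥k ↥Γ(X, U) :=
  (secHom k X U).toAlgebra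

/-- Algebraic differential forms on an open `U` of a scheme `X` over `Spec k`:
the exterior algebra of the module of Kähler differentials of `Γ(X, U)` over `k`. -/
noncomputable def FormsOn (U : X.Opens) : Type u :=
  letI := secAlgebra k X U
  ExteriorAlgebra ↥Γ(X, U) (Ω[↥Γ(X, U)⁄↥k])

/-- `w` is a differential form of degree `n` on `U`, i.e. lies in the `n`-th
exterior power of the Kähler differentials. -/
noncomputable def FormsOn.IsDegree (n : ℕ) (U : X.Opens) (w : FormsOn k X U) : Prop :=
  letI := secAlgebra k X U
  w ∈ ⋀[↥Γ(X, U)]^n (Ω[↥Γ(X, U)⁄↥k])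

/-- The degree `n` form `w` on `U` generates the module of degree `n` forms on `U`
(equivalently, the section `w` of the line bundle `Ω^n` trivializes it over `U`,
i.e. has no zeros on `U`). -/
noncomputable def FormsOn.Generates (n : ℕ) (U : X.Opens) (w : FormsOn k X U) : Prop :=
  letI := secAlgebra k X U
  let w' : ExteriorAlgebra ↥Γ(X, U) (Ω[↥Γ(X, U)⁄↥k]) := w
  (⋀[↥Γ(X, U)]^n (Ω[↥Γ(X, U)⁄↥k]) : Submodule ↥Γ(X, U) _) ≤
    Submodule.span ↥Γ(X, U) {w'}

variable {X} in
/-- Pullback of differential forms along a morphism `g : Z ⟶ X` of schemes over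
`Spec k`, from an open `U ⊆ X` to an open `W ⊆ Z` with `W ≤ g⁻¹(U)`.
Taking `g = 𝟙 X` gives restriction of forms to smaller opens. -/
noncomputable def formPullback {Z : Scheme.{u}} [Z.Over (Spec k)]
    (g : Z ⟶ X) (hg : g ≫ (X ↘ Spec k) = Z ↘ Spec k)
    (U : X.Opens) (W : Z.Opens) (e : W ≤ g ⁻¹ᵁ U) :
    FormsOn k X U → FormsOn k Z W :=
  letI := secAlgebra k X U
  letI := secAlgebra k Z W
  letI : Algebra ↥Γ(X, U) ↥Γ(Z, W) := RingHom.toAlgebra (g.appLE U W e : Γ(X, U) ⟶ Γ(Z, W)).hom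
  letI : IsScalarTower ↥k ↥Γ(X, U) ↥Γ(Z, W) := IsScalarTower.of_algebraMap_eq' (by
    show secHom k Z W = RingHom.comp (g.appLE U W e : Γ(X, U) ⟶ Γ(Z, W)).hom (secHom k X U)
    have h : ((Scheme.ΓSpecIso k).inv ≫ (Z ↘ Spec k).appTop ≫
          Z.presheaf.map (homOfLE le_top).op : k ⟶ Γ(Z, W))
        = (Scheme.ΓSpecIso k).inv ≫ (X ↘ Spec k).appTop ≫
          X.presheaf.map (homOfLE le_top).op ≫ g.appLE U W e := by
      rw [← hg]
      simp [Scheme.Hom.appLE, Scheme.Hom.app, Scheme.Hom.appTop, ← Functor.map_comp,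
        ← op_comp, homOfLE_comp]
      rfl
    exact congrArg CommRingCat.Hom.hom h)
  formTransfer ↥k ↥Γ(X, U) ↥Γ(Z, W)

/-- A gauge form of degree `n` on a scheme `X` over `Spec k`: a nowhere vanishing
global section of the sheaf `Ω^n_{X/k}` of degree `n` differential forms, given as a
compatible family of degree `n` forms on all affine opens, generating the sheaf of
degree `n` forms everywhere. The canonical line bundle `Ω^n_X` of a smooth
`n`-dimensional `X` is trivial if and only if a gauge form of degree `n` exists. -/
structure GaugeForm (n : ℕ) : Type u where
  form : ∀ U : X.Opens, IsAffineOpen U → FormsOn k X U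
  isDegree : ∀ U hU, FormsOn.IsDegree k X n U (form U hU)
  compat : ∀ (U V : X.Opens) (hU : IsAffineOpen U) (hV : IsAffineOpen V) (e : V ≤ U),
    formPullback k (𝟙 X) (Category.id_comp _) U V (by simpa using e) (form U hU) = form V hV
  generates : ∀ U hU, FormsOn.Generates k X n U (form U hU)

/-- Complex projective space `ℙ^N` as a scheme: `Proj ℂ[x_0, …, x_N]`. -/
noncomputable def ComplexProjSpace (N : ℕ) : Scheme :=
  Proj (MvPolynomial.homogeneousSubmodule (Fin (N + 1)) ℂ)

/-- A scheme is projective (over `ℂ`) if it admits a closed immersion into some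
complex projective space. -/
def IsProjectiveComplexVariety (X : Scheme) : Prop :=
  ∃ (N : ℕ) (i : X ⟶ ComplexProjSpace N), IsClosedImmersion i

/-- A subset `Z` of a (sober) topological space has codimension at least 2:
every point of `Z` admits a chain of two strict generizations. For a closed subset
`Z` of a scheme this says precisely that `Z` has codimension at least 2. -/
def codimAtLeastTwo (T : Type*) [TopologicalSpace T] (Z : Set T) : Prop :=
  ∀ z ∈ Z, ∃ y₁ y₂ : T, y₁ ≠ z ∧ y₂ ≠ y₁ ∧ z ∈ closure {y₁} ∧ y₁ ∈ closure {y₂}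

end BirGeo

end

open BirGeo


namespace BirProof

theorem isIntegral_of_ideal {R K : Type*} [CommRing R] [IsDomain R] [IsNoetherianRing R]
    [Field K] [Algebra R K] [IsFractionRing R K] (z : K) (I : Ideal R) (hI : I ≠ ⊥)
    (h : ∀ r ∈ I, ∃ s ∈ I, algebraMap R K r * z = algebraMap R K s) : IsIntegral R z := by
  let N : Submodule R K := Submodule.map (Algebra.linearMap R K) I
  have hinj : Function.Injective (algebraMap R K) := IsFractionRing.injective R K
  refine isIntegral_of_smul_mem_submodule (M := K) N ?_ ?_ z ?_
  · obtain ⟨a, ha, ha0⟩ := Submodule.exists_mem_ne_zero_of_ne_bot hI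
    intro hN
    have : algebraMap R K a ∈ N := ⟨a, ha, rfl⟩
    rw [hN, Submodule.mem_bot] at this
    exact ha0 ((map_eq_zero_iff _ hinj).mp this)
  · exact Submodule.FG.map _ (IsNoetherian.noetherian I)
  · rintro _ ⟨r, hr, rfl⟩
    obtain ⟨s, hs, e⟩ := h r hr
    refine ⟨s, hs, ?_⟩
    rw [Algebra.linearMap_apply, Algebra.linearMap_apply, ← e, smul_eq_mul, mul_comm]

theorem hartogs {R K : Type*} [CommRing R] [IsDomain R] [IsNoetherianRing R]
    [IsIntegrallyClosed R] [Field K] [Algebra R K] [IsFractionRing R K] (x : K)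
    (h : ∀ p : Ideal R, p.IsPrime → p ≠ ⊥ → (∀ q : Ideal R, q.IsPrime → q < p → q = ⊥) →
      ∃ s, s ∉ p ∧ ∃ r, algebraMap R K s * x = algebraMap R K r) :
    ∃ r, algebraMap R K r = x := by
  by_contra hx
  let N : Submodule R K := LinearMap.range (Algebra.linearMap R K)
  have memN : ∀ y : K, y ∈ N ↔ ∃ r, algebraMap R K r = y := fun y => Iff.rfl
  have hinj : Function.Injective (algebraMap R K) := IsFractionRing.injective R K
  have hx' : (Submodule.Quotient.mk x : K ⧸ N) ≠ 0 := by
    rw [Ne, Submodule.Quotient.mk_eq_zero]; exact hx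
  obtain ⟨P, hP, hle⟩ := exists_le_isAssociatedPrime_of_isNoetherianRing R _ hx'
  rw [isAssociatedPrime_iff] at hP
  obtain ⟨hPp, z, hz⟩ := hP
  obtain ⟨z, rfl⟩ := Submodule.Quotient.mk_surjective _ z
  have memP : ∀ r, r ∈ P ↔ ∃ s, algebraMap R K s = algebraMap R K r * z := by
    intro r
    rw [hz, Submodule.mem_colon_singleton, Submodule.mem_bot, ← Submodule.Quotient.mk_smul,
      Submodule.Quotient.mk_eq_zero, memN, Algebra.smul_def]
  have hzN : ¬ ∃ r, algebraMap R K r = z := by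
    intro hh
    apply hPp.ne_top
    rw [Ideal.eq_top_iff_one, memP]
    simpa using hh
  have hzint : ¬ IsIntegral R z := fun hh => hzN (IsIntegrallyClosed.isIntegral_iff.mp hh)
  have hP0 : P ≠ ⊥ := by
    obtain ⟨a, b, hb, e⟩ := IsFractionRing.div_surjective (A := R) z
    intro hbot
    have : b ∈ P := by
      rw [memP]
      refine ⟨a, ?_⟩
      have : algebraMap R K b ≠ 0 := by
        simpa using nonZeroDivisors.ne_zero hb
      rw [← e]; field_simp
    rw [hbot] at this
    exact nonZeroDivisors.ne_zero hb this
  obtain ⟨s, hs, r, e⟩ := h P hPp hP0 (by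
    intro q hq hqP
    by_contra hq0
    have ⟨t, ht, u, hu, e⟩ : ∃ t ∈ P, ∃ u, u ∉ P ∧ algebraMap R K t * z = algebraMap R K u := by
      by_contra hcon
      push Not at hcon
      apply hzint
      refine isIntegral_of_ideal z P hP0 fun r hr => ?_
      obtain ⟨s, hs⟩ := (memP r).mp hr
      exact ⟨s, by_contra fun hsP => hcon r hr s hsP hs.symm, hs.symm⟩
    have htq : t ∉ q := by
      intro htq
      apply hqP.not_ge
      intro r hr
      obtain ⟨s, hs⟩ := (memP r).mp hr
      have : r * u = s * t := by
        apply hinj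
        rw [map_mul, map_mul, ← e, hs]; ring
      refine (hq.mem_or_mem (x := r) (y := u) ?_).resolve_right fun hh => hu (hqP.le hh)
      rw [this]; exact q.mul_mem_left _ htq
    apply hzint
    refine isIntegral_of_ideal z q hq0 fun r hr => ?_
    obtain ⟨s, hs⟩ := (memP r).mp (hqP.le hr)
    have : s * t = r * u := by
        apply hinj
        rw [map_mul, map_mul, ← e, hs]; ring
    refine ⟨s, (hq.mem_or_mem (x := s) (y := t) ?_).resolve_right htq, hs.symm⟩
    rw [this]; exact q.mul_mem_right _ hr)
  apply hs
  apply hle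
  rw [Submodule.mem_colon_singleton, Submodule.mem_bot, ← Submodule.Quotient.mk_smul,
      Submodule.Quotient.mk_eq_zero, memN, Algebra.smul_def]
  exact ⟨r, e.symm⟩

theorem bijective_of_flat_birational {R S K : Type*} [CommRing R] [CommRing S] [IsLocalRing R]
    [IsLocalRing S] [Field K] [Algebra R S] [Algebra S K] [Algebra R K] [IsScalarTower R S K]
    [IsDomain R] [IsDomain S] [IsFractionRing R K]
    (hSK : Function.Injective (algebraMap S K))
    [Module.Flat R S] [IsLocalHom (algebraMap R S)] : Function.Bijective (algebraMap R S) := by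
  have hinj : Function.Injective (algebraMap R K) := IsFractionRing.injective R K
  have := Module.FaithfullyFlat.of_flat_of_isLocalHom (A := R) (B := S)
  constructor
  · rw [IsScalarTower.algebraMap_eq R S K] at hinj
    exact Function.Injective.of_comp hinj
  · intro s
    obtain ⟨a, b, hb, e⟩ := IsFractionRing.div_surjective (A := R) (algebraMap S K s)
    have hb0 : algebraMap R K b ≠ 0 := by simpa using nonZeroDivisors.ne_zero hb
    have e1 : algebraMap R S a = algebraMap R S b * s := by
      apply hSK
      rw [map_mul, ← IsScalarTower.algebraMap_apply, ← IsScalarTower.algebraMap_apply, ← e]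
      field_simp
    have : a ∈ ((Ideal.span {b}).map (algebraMap R S)).comap (algebraMap R S) := by
      rw [Ideal.mem_comap, e1, Ideal.map_span, Set.image_singleton]
      exact Ideal.mul_mem_right _ _ (Ideal.mem_span_singleton_self _)
    rw [Ideal.comap_map_eq_self_of_faithfullyFlat, Ideal.mem_span_singleton] at this
    obtain ⟨r, rfl⟩ := this
    refine ⟨r, ?_⟩
    apply hSK
    have := congrArg (algebraMap S K) e1
    rw [map_mul, map_mul, map_mul, ← IsScalarTower.algebraMap_apply] at this
    exact mul_left_cancel₀ hb0 this


open TensorProduct in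
attribute [local instance] Algebra.TensorProduct.rightAlgebra in
/-- A domain étale over a normal domain is normal. -/
theorem isIntegrallyClosed_of_etale {R S : Type*} [CommRing R] [CommRing S] [IsDomain R]
    [IsDomain S] [IsIntegrallyClosed R] [Algebra R S] [Algebra.Etale R S] :
    IsIntegrallyClosed S := by
  let L := FractionRing R
  let T := S ⊗[R] L
  have hflat : Module.Flat R S := inferInstance
  have hinjR : Function.Injective (algebraMap R S) := FaithfulSMul.algebraMap_injective R S
  have hM : Algebra.algebraMapSubmonoid S (nonZeroDivisors R) ≤ nonZeroDivisors S := by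
    rintro _ ⟨r, hr, rfl⟩
    have hr : r ∈ nonZeroDivisors R := hr
    rw [mem_nonZeroDivisors_iff_ne_zero] at hr ⊢
    exact (map_ne_zero_iff _ hinjR).mpr hr
  have hloc : IsLocalization (Algebra.algebraMapSubmonoid S (nonZeroDivisors R)) T :=
    inferInstance
  have hdom : IsDomain T := IsLocalization.isDomain_of_le_nonZeroDivisors T hM
  have hinjT : Function.Injective (algebraMap S T) := IsLocalization.injective T hM
  have b := TensorProduct.toIntegralClosure_bijective_of_smooth (R := R) (S := S) (B := L)
  have het : Algebra.Etale L T :=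
    Algebra.Etale.of_equiv ((Algebra.TensorProduct.commRight R L S))
  have hfin : Module.Finite L T := Algebra.FormallyUnramified.finite_of_free L T
  have hfield : IsField T := isField_of_isIntegral_of_isField' (Field.toIsField L)
  let := hfield.toField
  have hfr : IsFractionRing S T := by
    have : FaithfulSMul S T := (faithfulSMul_iff_algebraMap_injective S T).mpr hinjT
    apply IsFractionRing.of_field
    intro z
    obtain ⟨x, y, h⟩ := IsLocalization.exists_mk'_eq
      (Algebra.algebraMapSubmonoid S (nonZeroDivisors R)) z
    refine ⟨x, y, ?_⟩
    rw [← h, eq_div_iff, IsLocalization.mk'_spec]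
    exact (map_ne_zero_iff _ hinjT).mpr (nonZeroDivisors.ne_zero (hM y.2))
  rw [isIntegrallyClosed_iff T]
  intro x hx
  obtain ⟨y, hy⟩ := b.2 ⟨x, hx⟩
  have hy' : Algebra.TensorProduct.map (.id S S) (integralClosure R L).val y = x :=
    congrArg Subtype.val hy
  clear hy
  rw [← hy']
  clear hy' hx
  induction y with
  | zero => exact ⟨0, by simp⟩
  | add u v hu hv =>
    obtain ⟨u', hu⟩ := hu
    obtain ⟨v', hv⟩ := hv
    exact ⟨u' + v', by rw [map_add, map_add, hu, hv]⟩
  | tmul s l =>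
    obtain ⟨l, hl⟩ := l
    obtain ⟨r, rfl⟩ := IsIntegrallyClosed.isIntegral_iff.mp hl
    refine ⟨s * algebraMap R S r, ?_⟩
    simp only [Algebra.TensorProduct.map_tmul]
    change (s * algebraMap R S r) ⊗ₜ[R] (1 : L) = s ⊗ₜ[R] (algebraMap R L r)
    rw [Algebra.algebraMap_eq_smul_one (A := L), TensorProduct.tmul_smul, mul_comm,
      ← Algebra.smul_def, TensorProduct.smul_tmul']

/-- Local rings of a smooth domain over a field are normal. -/
theorem isIntegrallyClosed_localization_of_smooth {k S : Type*} [Field k] [CommRing S]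
    [IsDomain S] [Algebra k S] [Algebra.Smooth k S] (p : Ideal S) [p.IsPrime]
    (Sp : Type*) [CommRing Sp] [Algebra S Sp] [IsLocalization.AtPrime Sp p] :
    IsIntegrallyClosed Sp := by
  obtain ⟨f, hfm, n, _, _, _⟩ :=
      Algebra.IsSmoothAt.exists_isStandardEtale_mvPolynomial (R := k) (p := p)
  have hf0 : f ≠ 0 := fun h => hfm (h ▸ p.zero_mem)
  have hle : Submonoid.powers f ≤ nonZeroDivisors S :=
    powers_le_nonZeroDivisors_of_noZeroDivisors hf0
  have hdom : IsDomain (Localization.Away f) :=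
    IsLocalization.isDomain_of_le_nonZeroDivisors _ hle
  have hcl : IsIntegrallyClosed (Localization.Away f) :=
    isIntegrallyClosed_of_etale (R := MvPolynomial (Fin n) k)
  have hle' : Submonoid.powers f ≤ p.primeCompl := by
    rw [Submonoid.powers_le]; exact hfm
  let : Algebra (Localization.Away f) Sp :=
    IsLocalization.localizationAlgebraOfSubmonoidLe (Localization.Away f) Sp
      (Submonoid.powers f) p.primeCompl hle'
  have : IsScalarTower S (Localization.Away f) Sp :=
    IsLocalization.localization_isScalarTower_of_submonoid_le _ _ _ _ hle'
  have := IsLocalization.isLocalization_of_submonoid_le (Localization.Away f) Sp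
    (Submonoid.powers f) p.primeCompl hle'
  refine isIntegrallyClosed_of_isLocalization (R := Localization.Away f)
    (M := p.primeCompl.map (algebraMap S (Localization.Away f))) _ ?_
  rintro _ ⟨r, hr, rfl⟩
  rw [mem_nonZeroDivisors_iff_ne_zero]
  refine (map_ne_zero_iff _ (IsLocalization.injective _ hle)).mpr fun h => ?_
  subst h
  exact hr p.zero_mem

/-- An algebraically closed field inside the fraction field of a DVR lies in the DVR. -/
theorem mem_dvr_of_algClosed {F R K : Type*} [Field F] [IsAlgClosed F] [CommRing R] [IsDomain R]
    [IsDiscreteValuationRing R] [Field K] [Algebra R K] [IsFractionRing R K] (φ : F →+* K) (a : F) :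
    ∃ r, algebraMap R K r = φ a := by
  by_contra hcon
  have h0 : φ a ≠ 0 := fun h => hcon ⟨0, by rw [h, map_zero]⟩
  have hinj : Function.Injective (algebraMap R K) := IsFractionRing.injective R K
  obtain ⟨r, hr⟩ : ∃ r, algebraMap R K r = (φ a)⁻¹ := by
    obtain ⟨r, hr⟩ | ⟨r, hr⟩ := ValuationRing.isInteger_or_isInteger R (φ a)
    · exact (hcon ⟨r, hr⟩).elim
    · exact ⟨r, hr⟩
  have hr0 : r = 0 := by
    rw [← Ideal.mem_bot, ← Ideal.iInf_pow_eq_bot_of_isLocalRing (R := R)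
      (IsLocalRing.maximalIdeal R) (Ideal.IsPrime.ne_top'), Ideal.mem_iInf]
    intro N
    by_cases hN : N = 0
    · simp [hN]
    obtain ⟨b, hb⟩ := IsAlgClosed.exists_pow_nat_eq (a⁻¹) (Nat.pos_of_ne_zero hN)
    have hb' : φ b ^ N = algebraMap R K r := by rw [hr, ← map_pow, hb, map_inv₀]
    obtain ⟨t, ht⟩ := IsIntegrallyClosed.exists_algebraMap_eq_of_isIntegral_pow
      (R := R) (x := φ b) (Nat.pos_of_ne_zero hN) (hb' ▸ isIntegral_algebraMap)
    have htr : t ^ N = r := by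
      apply hinj
      rw [map_pow, ht, hb']
    rw [← htr]
    apply Ideal.pow_mem_pow
    rw [IsLocalRing.mem_maximalIdeal, mem_nonunits_iff]
    intro hu
    obtain ⟨v, hv⟩ := (hu.pow N)
    apply hcon
    refine ⟨(v⁻¹ : Rˣ), ?_⟩
    rw [htr] at hv
    have : algebraMap R K (v⁻¹ : Rˣ) * algebraMap R K v = 1 := by
      rw [← map_mul]; simp
    rw [hv, hr] at this
    field_simp at this
    exact this
  rw [hr0, map_zero] at hr
  exact h0 (inv_eq_zero.mp hr.symm)

end BirProof


namespace BirProof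
section forms
variable (R A B C : Type u) [CommRing R] [CommRing A] [CommRing B] [CommRing C]
    [Algebra R A] [Algebra R B] [Algebra A B] [IsScalarTower R A B]

theorem ft_spec : ∃ φ : ExteriorAlgebra A (Ω[A⁄R]) →+* ExteriorAlgebra B (Ω[B⁄R]),
    (∀ w, formTransfer R A B w = φ w) ∧
    (∀ a, φ (algebraMap A _ a) = algebraMap B _ (algebraMap A B a)) ∧
    (∀ m, φ (ExteriorAlgebra.ι A m) = ExteriorAlgebra.ι B (KaehlerDifferential.map R R A B m)) := by
  let _ : Algebra A (ExteriorAlgebra B (Ω[B⁄R])) :=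
    Algebra.compHom (ExteriorAlgebra B (Ω[B⁄R])) (algebraMap A B)
  let _ : @IsScalarTower A B (ExteriorAlgebra B (Ω[B⁄R])) _ Algebra.toSMul Algebra.toSMul :=
    IsScalarTower.of_algebraMap_eq' rfl
  refine ⟨(ExteriorAlgebra.lift A
      ⟨(LinearMap.restrictScalars A
          (ExteriorAlgebra.ι B (M := Ω[B⁄R]))).comp (KaehlerDifferential.map R R A B),
        fun m => by
          simp [ExteriorAlgebra.ι_sq_zero (R := B) ((KaehlerDifferential.map R R A B) m)]⟩ ).toRingHom,
          fun w => rfl, fun a => ?_, fun m => ?_⟩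
  · exact AlgHom.commutes _ a
  · exact ExteriorAlgebra.lift_ι_apply _ _ _ _

noncomputable def ftHom : ExteriorAlgebra A (Ω[A⁄R]) →+* ExteriorAlgebra B (Ω[B⁄R]) := (ft_spec R A B).choose

theorem formTransfer_eq (w) : formTransfer R A B w = ftHom R A B w := (ft_spec R A B).choose_spec.1 w

theorem ftHom_algebraMap (a : A) : ftHom R A B (algebraMap A _ a) = algebraMap B _ (algebraMap A B a) :=
  (ft_spec R A B).choose_spec.2.1 a

theorem ftHom_ι (m) : ftHom R A B (ExteriorAlgebra.ι A m) = ExteriorAlgebra.ι B (KaehlerDifferential.map R R A B m) :=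
  (ft_spec R A B).choose_spec.2.2 m

theorem ftHom_smul (a : A) (w) : ftHom R A B (a • w) = algebraMap A B a • ftHom R A B w := by
  rw [Algebra.smul_def, map_mul, ftHom_algebraMap, Algebra.smul_def]

theorem ftHom_ιMulti (n : ℕ) (v : Fin n → Ω[A⁄R]) :
    ftHom R A B (ExteriorAlgebra.ιMulti A n v) =
      ExteriorAlgebra.ιMulti B n (fun i => KaehlerDifferential.map R R A B (v i)) := by
  rw [ExteriorAlgebra.ιMulti_apply, ExteriorAlgebra.ιMulti_apply, map_list_prod, List.map_ofFn]
  congr 2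
  funext i
  exact ftHom_ι R A B (v i)

theorem ftHom_mem (n : ℕ) {w} (hw : w ∈ ⋀[A]^n (Ω[A⁄R])) : ftHom R A B w ∈ ⋀[B]^n (Ω[B⁄R]) := by
  rw [← ExteriorAlgebra.ιMulti_span_fixedDegree] at hw
  induction hw using Submodule.span_induction with
  | mem x h =>
    obtain ⟨v, rfl⟩ := h
    rw [ftHom_ιMulti, ← ExteriorAlgebra.ιMulti_span_fixedDegree]
    exact Submodule.subset_span ⟨_, rfl⟩
  | zero => rw [map_zero]; exact Submodule.zero_mem _
  | add x y _ _ hx hy => rw [map_add]; exact Submodule.add_mem _ hx hy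
  | smul a x _ hx => rw [ftHom_smul]; exact Submodule.smul_mem _ _ hx

theorem ftHom_comp [Algebra R C] [Algebra A C] [Algebra B C] [IsScalarTower R A C]
    [IsScalarTower R B C] [IsScalarTower A B C] (w) :
    ftHom R B C (ftHom R A B w) = ftHom R A C w := by
  induction w using ExteriorAlgebra.induction with
  | algebraMap r => rw [ftHom_algebraMap, ftHom_algebraMap, ftHom_algebraMap, ← IsScalarTower.algebraMap_apply A B C]
  | ι x =>
    simp only [ftHom_ι]
    congr 1
    have : x ∈ Submodule.span A (Set.range (KaehlerDifferential.D R A)) := by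
      rw [KaehlerDifferential.span_range_derivation]; trivial
    induction this using Submodule.span_induction with
    | mem x h => obtain ⟨a, rfl⟩ := h; simp [← IsScalarTower.algebraMap_apply]
    | zero => simp
    | add x y _ _ hx hy => simp only [map_add, hx, hy]
    | smul a x _ hx =>
      simp only [map_smul, hx]
      rw [← algebraMap_smul B a (KaehlerDifferential.map R R A B x), map_smul, hx, algebraMap_smul]
  | mul a b ha hb => simp only [map_mul, ha, hb]
  | add a b ha hb => simp only [map_add, ha, hb]

end forms

section det
variable {B M : Type*} [CommRing B] [AddCommGroup M] [Module B M]

open Classical in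
noncomputable def detFun {n : ℕ} (b : Module.Basis (Fin n) B M) : ExteriorAlgebra B M →ₗ[B] B :=
  ExteriorAlgebra.liftAlternating (Pi.single n b.det)

theorem detFun_ιMulti {n : ℕ} (b : Module.Basis (Fin n) B M) (v : Fin n → M) :
    detFun b (ExteriorAlgebra.ιMulti B n v) = b.det v := by
  rw [detFun, ExteriorAlgebra.liftAlternating_apply_ιMulti, Pi.single_eq_same]
end det

section etale
variable {R A B : Type u} [CommRing R] [CommRing A] [CommRing B]
    [Algebra R A] [Algebra R B] [Algebra A B] [IsScalarTower R A B]

theorem etale_of_generates {n : ℕ} (bA : Module.Basis (Fin n) A (Ω[A⁄R]))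
    (bB : Module.Basis (Fin n) B (Ω[B⁄R])) [Algebra.Smooth R B] [Algebra.FiniteType R A]
    (wA : ExteriorAlgebra A (Ω[A⁄R])) (wB : ExteriorAlgebra B (Ω[B⁄R]))
    (hA : wA ∈ ⋀[A]^n (Ω[A⁄R])) (hB : ⋀[B]^n (Ω[B⁄R]) ≤ Submodule.span B {wB})
    (c : B) (hc : IsUnit c) (h : ftHom R A B wA = c • wB) : Algebra.Etale A B := by
  let e' := bA.baseChange B
  let f : (TensorProduct A B (Ω[A⁄R])) [⋀^Fin n]→ₗ[B] B :=
    bB.det.compLinearMap (KaehlerDifferential.mapBaseChange R A B)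
  have hf : f = f e' • e'.det := AlternatingMap.eq_smul_basis_det e' f
  have key : ∀ w ∈ ⋀[A]^n (Ω[A⁄R]), f e' ∣ detFun bB (ftHom R A B w) := by
    intro w hw
    rw [← ExteriorAlgebra.ιMulti_span_fixedDegree] at hw
    induction hw using Submodule.span_induction with
    | mem x h =>
      obtain ⟨v, rfl⟩ := h
      rw [ftHom_ιMulti, detFun_ιMulti]
      have h1 : f (fun i => 1 ⊗ₜ v i) = bB.det (fun i => KaehlerDifferential.map R R A B (v i)) := by
        simp only [f, AlternatingMap.compLinearMap_apply]
        congr 1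
        funext i
        simp
      rw [← h1, hf]
      simp only [AlternatingMap.smul_apply, smul_eq_mul]
      rw [Module.Basis.det_self, mul_one]
      exact dvd_mul_right _ _
    | zero => simp
    | add x y _ _ hx hy => simp only [map_add]; exact dvd_add hx hy
    | smul a x _ hx => rw [ftHom_smul, map_smul]; exact Dvd.dvd.mul_left hx _
  have hu : IsUnit (f e') := by
    have h1 : ExteriorAlgebra.ιMulti B n bB ∈ Submodule.span B {wB} := by
      apply hB
      rw [← ExteriorAlgebra.ιMulti_span_fixedDegree]
      exact Submodule.subset_span ⟨_, rfl⟩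
    obtain ⟨r, hr⟩ := Submodule.mem_span_singleton.mp h1
    have h2 : (1 : B) = r * detFun bB wB := by
      rw [← smul_eq_mul, ← map_smul, hr, detFun_ιMulti, Module.Basis.det_self]
    have h3 := key wA hA
    rw [h, map_smul, smul_eq_mul, hc.dvd_mul_left] at h3
    exact isUnit_of_dvd_one (h2 ▸ Dvd.dvd.mul_left h3 r)
  have hu' : IsUnit (bB.det (fun i => KaehlerDifferential.mapBaseChange R A B (e' i))) := hu
  obtain ⟨hli, hsp⟩ := (Module.Basis.is_basis_iff_det bB).mpr hu'
  have hinj : Function.Injective (KaehlerDifferential.mapBaseChange R A B) := by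
    rw [← LinearMap.ker_eq_bot, LinearMap.ker_eq_bot']
    intro x hx
    rw [Fintype.linearIndependent_iff] at hli
    have h1 := hli (fun i => e'.repr x i) (by
      rw [← e'.sum_repr x] at hx
      simpa only [map_sum, map_smul] using hx)
    rw [← e'.sum_repr x]
    exact Finset.sum_eq_zero (fun i _ => by rw [h1 i, zero_smul])
  have hsurj : Function.Surjective (KaehlerDifferential.mapBaseChange R A B) := by
    rw [← LinearMap.range_eq_top, eq_top_iff, ← hsp, Submodule.span_le]
    rintro _ ⟨i, rfl⟩
    exact ⟨e' i, rfl⟩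
  have hO : Subsingleton (Ω[B⁄A]) := by
    refine ⟨fun x y => ?_⟩
    have : ∀ x : Ω[B⁄A], x = 0 := by
      intro x
      obtain ⟨y, rfl⟩ := KaehlerDifferential.map_surjective R A B x
      exact (KaehlerDifferential.exact_mapBaseChange_map R A B y).mpr (hsurj y)
    rw [this x, this y]
  have hH : Subsingleton (Algebra.H1Cotangent A B) := by
    have h0 : ∀ x : Algebra.H1Cotangent A B, x = 0 := by
      intro x
      have h1 : Algebra.H1Cotangent.δ R A B x = 0 := by
        apply hinj
        rw [map_zero]
        exact (Algebra.H1Cotangent.exact_δ_mapBaseChange R A B _).mpr ⟨x, rfl⟩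
      obtain ⟨y, rfl⟩ := (Algebra.H1Cotangent.exact_map_δ R A B _).mp h1
      rw [Subsingleton.elim y 0, map_zero]
    exact ⟨fun x y => by rw [h0 x, h0 y]⟩
  have : Algebra.FormallyEtale A B := ⟨hO, hH⟩
  have := Algebra.FinitePresentation.of_restrict_scalars_finitePresentation R A B
  exact Algebra.Etale.mk

theorem ftHom_ne_zero {K : Type u} [Field K] [Algebra R K] [Algebra B K] [IsScalarTower R B K]
    [IsDomain B] [IsFractionRing B K] {n : ℕ}
    (bB : Module.Basis (Fin n) B (Ω[B⁄R])) (wB : ExteriorAlgebra B (Ω[B⁄R]))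
    (hB : ⋀[B]^n (Ω[B⁄R]) ≤ Submodule.span B {wB}) : ftHom R B K wB ≠ 0 := by
  intro h0
  have h1 : ExteriorAlgebra.ιMulti B n bB ∈ Submodule.span B {wB} := by
    apply hB
    rw [← ExteriorAlgebra.ιMulti_span_fixedDegree]
    exact Submodule.subset_span ⟨_, rfl⟩
  obtain ⟨r, hr⟩ := Submodule.mem_span_singleton.mp h1
  have h2 : ftHom R B K (ExteriorAlgebra.ιMulti B n bB) = 0 := by
    rw [← hr, ftHom_smul, h0, smul_zero]
  let bK := Module.Basis.ofIsLocalizedModule K (nonZeroDivisors B) (KaehlerDifferential.map R R B K) bB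
  rw [ftHom_ιMulti] at h2
  have h3 := congrArg (detFun bK) h2
  rw [detFun_ιMulti, map_zero] at h3
  have : (fun i => KaehlerDifferential.map R R B K (bB i)) = bK := by
    funext i; exact (Module.Basis.ofIsLocalizedModule_apply K _ _ bB i).symm
  rw [this, Module.Basis.det_self] at h3
  exact one_ne_zero h3

theorem exists_coeff {K : Type u} [Field K] [Algebra R K] [Algebra B K] [IsScalarTower R B K]
    [Algebra A K] [IsScalarTower R A K] [IsScalarTower A B K] {n : ℕ}
    (wA : ExteriorAlgebra A (Ω[A⁄R])) (wB : ExteriorAlgebra B (Ω[B⁄R]))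
    (hA : wA ∈ ⋀[A]^n (Ω[A⁄R])) (hB : ⋀[B]^n (Ω[B⁄R]) ≤ Submodule.span B {wB}) :
    ∃ b : B, ftHom R A B wA = b • wB ∧ ftHom R A K wA = algebraMap B K b • ftHom R B K wB := by
  obtain ⟨b, hb⟩ := Submodule.mem_span_singleton.mp (hB (ftHom_mem R A B n hA))
  refine ⟨b, hb.symm, ?_⟩
  rw [← ftHom_smul, hb, ftHom_comp]

end etale
end BirProof

namespace BirProof
section gen
variable {X Y S : Scheme.{0}} [IsIntegral X] [IsIntegral Y] {K : Type} [Field K]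

/-- generic point -/
noncomputable def gpt (φ : X.functionField ≅ CommRingCat.of K) : Spec (CommRingCat.of K) ⟶ X :=
  Spec.map φ.hom ≫ X.fromSpecStalk (genericPoint X)

noncomputable def toK (φ : X.functionField ≅ CommRingCat.of K) (x : X) :
    X.presheaf.stalk x ⟶ CommRingCat.of K :=
  X.presheaf.stalkSpecializes (genericPoint_specializes x) ≫ φ.hom

theorem toK_comp (φ : X.functionField ≅ CommRingCat.of K) (x : X) :
    Spec.map (toK φ x) ≫ X.fromSpecStalk x = gpt φ := by
  simp [toK, gpt, Scheme.SpecMap_stalkSpecializes_fromSpecStalk]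

theorem gpt_apply (φ : X.functionField ≅ CommRingCat.of K) (p) : gpt φ p = genericPoint X := by
  have h : gpt φ p ∈ Set.range (X.fromSpecStalk (genericPoint X)) := by
    rw [gpt]; exact ⟨_, rfl⟩
  rw [Scheme.range_fromSpecStalk] at h
  exact (h.antisymm (genericPoint_specializes _)).eq

theorem toK_isFractionRing (φ : X.functionField ≅ CommRingCat.of K) (x : X) :
    @IsFractionRing (X.presheaf.stalk x) _ K _ (toK φ x).hom.toAlgebra := by
  let _ := (toK φ x).hom.toAlgebra
  let e : X.functionField ≃ₐ[X.presheaf.stalk x] K :=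
    { φ.commRingCatIsoToRingEquiv with
      commutes' := fun r => rfl }
  exact IsLocalization.isLocalization_of_algEquiv _ e

theorem toK_injective (φ : X.functionField ≅ CommRingCat.of K) (x : X) :
    Function.Injective (toK φ x).hom := by
  let _ := (toK φ x).hom.toAlgebra
  have := toK_isFractionRing φ x
  exact IsFractionRing.injective (X.presheaf.stalk x) K

theorem isDominant_gpt_of (φ : X.functionField ≅ CommRingCat.of K) (U : X.Opens)
    (g : Spec (.of K) ⟶ U.toScheme) (hg : g ≫ U.ι = gpt φ) : IsDominant g := by
  constructor
  have p : Spec (.of K) := Classical.arbitrary _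
  have h : U.ι (g p) = genericPoint X := by
    rw [← gpt_apply φ p, ← hg, Scheme.Hom.comp_apply]
  intro z
  have h1 : g p ⤳ z := by
    rw [← U.ι.isOpenEmbedding.isInducing.specializes_iff, h]
    exact genericPoint_specializes _
  exact closure_mono (by rintro _ rfl; exact ⟨p, rfl⟩) h1.mem_closure

theorem ext_gpt (φ : X.functionField ≅ CommRingCat.of K) (U : X.Opens) {Z : Scheme.{0}} [Z.IsSeparated]
    (g : Spec (.of K) ⟶ U.toScheme) (hg : g ≫ U.ι = gpt φ) (a b : U.toScheme ⟶ Z)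
    (h : g ≫ a = g ≫ b) : a = b := by
  have := isDominant_gpt_of φ U g hg
  exact ext_of_isDominant_of_isSeparated (Limits.terminal.from Z) (Limits.terminal.hom_ext _ _) g h

instance isDominant_toK (φ : X.functionField ≅ CommRingCat.of K) (x : X) :
    IsDominant (Spec.map (toK φ x)) := by
  constructor
  have h : Function.Injective (toK φ x).hom := toK_injective φ x
  exact PrimeSpectrum.denseRange_comap_iff_ker_le_nilRadical _ |>.mpr (by
    rw [(RingHom.injective_iff_ker_eq_bot _).mp h]; exact bot_le)

theorem ext_toK (φ : X.functionField ≅ CommRingCat.of K) (x : X) {Z : Scheme.{0}} [Z.IsSeparated]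
    (a b : Spec (X.presheaf.stalk x) ⟶ Z)
    (h : Spec.map (toK φ x) ≫ a = Spec.map (toK φ x) ≫ b) : a = b :=
  ext_of_isDominant_of_isSeparated (Limits.terminal.from Z) (Limits.terminal.hom_ext _ _)
    (Spec.map (toK φ x)) h

theorem exists_lift (φ : X.functionField ≅ CommRingCat.of K) (U : X.Opens) (hU : genericPoint X ∈ U) :
    ∃ g : Spec (.of K) ⟶ U.toScheme, g ≫ U.ι = gpt φ := by
  refine ⟨IsOpenImmersion.lift U.ι (gpt φ) ?_, IsOpenImmersion.lift_fac _ _ _⟩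
  rintro _ ⟨p, rfl⟩
  rw [gpt_apply]
  simpa using hU

theorem exists_max (φ : X.functionField ≅ CommRingCat.of K) (ψ : Y.functionField ≅ CommRingCat.of K)
    [Y.IsSeparated] [S.IsSeparated] (sX : X ⟶ S) (sY : Y ⟶ S) [LocallyOfFiniteType sY]
    (h : gpt φ ≫ sX = gpt ψ ≫ sY) :
    ∃ (U : X.Opens) (F : U.toScheme ⟶ Y), genericPoint X ∈ U ∧ F ≫ sY = U.ι ≫ sX ∧
      (∀ g : Spec (.of K) ⟶ U.toScheme, g ≫ U.ι = gpt φ → g ≫ F = gpt ψ) ∧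
      ∀ x (p : Spec (X.presheaf.stalk x) ⟶ Y), Spec.map (toK φ x) ≫ p = gpt ψ → x ∈ U := by
  have h0 : (Spec.map φ.inv ≫ gpt ψ) ≫ sY = X.fromSpecStalk _ ≫ sX := by
    rw [Category.assoc, ← h, gpt, ← Category.assoc, ← Category.assoc, ← Spec.map_comp]
    simp
  let f : X ⤏ Y := Scheme.RationalMap.ofFunctionField sX sY (Spec.map φ.inv ≫ gpt ψ) h0
  have hf : f.fromFunctionField = Spec.map φ.inv ≫ gpt ψ :=
    Scheme.RationalMap.fromFunctionField_ofFunctionField _ _ _ _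
  let P := f.toPartialMap
  have hP : P.toRationalMap = f := Scheme.RationalMap.toRationalMap_toPartialMap f
  have hgen : genericPoint X ∈ P.domain :=
    (genericPoint_specializes _).mem_open P.domain.2 P.dense_domain.nonempty.choose_spec
  have hPf : P.fromFunctionField = Spec.map φ.inv ≫ gpt ψ := by
    rw [← hf, ← hP]; rfl
  have hgF : ∀ g : Spec (.of K) ⟶ P.domain.toScheme, g ≫ P.domain.ι = gpt φ → g ≫ P.hom = gpt ψ := by
    intro g hg
    have : g = Spec.map φ.hom ≫ P.domain.fromSpecStalkOfMem _ hgen := by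
      rw [← cancel_mono P.domain.ι, hg, Category.assoc, Scheme.Opens.fromSpecStalkOfMem_ι, gpt]
    rw [this, Category.assoc]
    have h2 : P.domain.fromSpecStalkOfMem _ hgen ≫ P.hom = Spec.map φ.inv ≫ gpt ψ := hPf
    rw [h2, ← Category.assoc, ← Spec.map_comp]
    simp
  refine ⟨P.domain, P.hom, hgen, ?_, hgF, ?_⟩
  · obtain ⟨g, hg⟩ := exists_lift φ P.domain hgen
    refine ext_gpt φ P.domain g hg _ _ ?_
    rw [← Category.assoc, hgF g hg, ← Category.assoc, hg, h]
  · intro x p hp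
    have hover : p ≫ sY = X.fromSpecStalk x ≫ sX := by
      refine ext_toK φ x _ _ ?_
      rw [← Category.assoc, hp, ← Category.assoc, toK_comp, h]
    let Q := Scheme.PartialMap.ofFromSpecStalk sX sY p hover
    have hx : x ∈ Q.domain := Scheme.PartialMap.mem_domain_ofFromSpecStalk sX sY p hover
    have hQ : Q.domain.fromSpecStalkOfMem x hx ≫ Q.hom = p :=
      Scheme.PartialMap.fromSpecStalkOfMem_ofFromSpecStalk sX sY p hover
    have hgQ : genericPoint X ∈ Q.domain := (genericPoint_specializes x).mem_open Q.domain.2 hx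
    have : Q.toRationalMap = f := by
      apply Scheme.RationalMap.eq_of_fromFunctionField_eq
      rw [hf]
      have e1 : Q.domain.fromSpecStalkOfMem _ hgQ =
          Spec.map (X.presheaf.stalkSpecializes (genericPoint_specializes x)) ≫
            Q.domain.fromSpecStalkOfMem x hx := by
        rw [← cancel_mono Q.domain.ι, Category.assoc, Scheme.Opens.fromSpecStalkOfMem_ι,
          Scheme.Opens.fromSpecStalkOfMem_ι, Scheme.SpecMap_stalkSpecializes_fromSpecStalk]
      change Q.domain.fromSpecStalkOfMem _ hgQ ≫ Q.hom = _
      rw [e1, Category.assoc, hQ, ← hp, toK, ← Category.assoc, ← Spec.map_comp]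
      simp
    exact Scheme.RationalMap.mem_domain.mpr ⟨Q, hx, this⟩

end gen
end BirProof

attribute [local instance] MvPolynomial.gradedAlgebra
namespace BirProof
section proper

theorem isSeparated_of_proj {Y : Scheme.{0}} (h : IsProjectiveComplexVariety Y) : Y.IsSeparated := by
  obtain ⟨N, i, hi⟩ := h
  have : (ComplexProjSpace N).IsSeparated := by
    unfold ComplexProjSpace; infer_instance
  constructor
  rw [← Limits.terminal.comp_from i]
  infer_instance

theorem valuative_proj {Y : Scheme.{0}} (hY : IsProjectiveComplexVariety Y)
    {R K : Type} [CommRing R] [IsDomain R] [IsDiscreteValuationRing R] [Field K] [Algebra R K]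
    [IsFractionRing R K] (y : Spec (.of K) ⟶ Y) :
    ∃ p : Spec (.of R) ⟶ Y, Spec.map (CommRingCat.ofHom (algebraMap R K)) ≫ p = y := by
  obtain ⟨N, i, hi⟩ := hY
  let 𝒜 := MvPolynomial.homogeneousSubmodule (Fin (N + 1)) ℂ
  have hst : @IsScalarTower ℂ (𝒜 0) (MvPolynomial (Fin (N + 1)) ℂ) Algebra.toSMul Algebra.toSMul
      Algebra.toSMul := IsScalarTower.of_algebraMap_eq' rfl
  have hft : Algebra.FiniteType (𝒜 0) (MvPolynomial (Fin (N + 1)) ℂ) :=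
    Algebra.FiniteType.of_restrictScalars_finiteType ℂ (𝒜 0) _
  let q : ComplexProjSpace N ⟶ Spec (.of (𝒜 0)) := Proj.toSpecZero 𝒜
  have hq : IsProper q := inferInstanceAs (IsProper (Proj.toSpecZero 𝒜))
  have hp : UniversallyClosed (i ≫ q) := inferInstance
  rw [UniversallyClosed.eq_valuativeCriterion] at hp
  let θ : CommRingCat.of (𝒜 0) ⟶ CommRingCat.of K := Spec.preimage (y ≫ i ≫ q)
  have hθ : Spec.map θ = y ≫ i ≫ q := Spec.map_preimage _
  have hinj : Function.Injective (algebraMap R K) := IsFractionRing.injective R K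
  have hr : ∀ a : 𝒜 0, θ.hom a ∈ (algebraMap R K).range := by
    rintro ⟨a, ha⟩
    obtain ⟨c, hc⟩ : ∃ c : ℂ, algebraMap ℂ (𝒜 0) c = ⟨a, ha⟩ := by
      have h1 : a.totalDegree = 0 := by
        have := (MvPolynomial.mem_homogeneousSubmodule 0 a).mp ha
        exact Nat.le_zero.mp this.totalDegree_le
      refine ⟨a.coeff 0, Subtype.ext ?_⟩
      exact (MvPolynomial.totalDegree_eq_zero_iff_eq_C.mp h1).symm
    obtain ⟨r, hr⟩ := mem_dvr_of_algClosed (R := R) (θ.hom.comp (algebraMap ℂ (𝒜 0))) c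
    refine ⟨r, ?_⟩
    rw [hr, RingHom.comp_apply, hc]
  let e : R ≃+* (algebraMap R K).range := RingEquiv.ofBijective (algebraMap R K).rangeRestrict
    ⟨fun a b h => hinj (congrArg Subtype.val h), RingHom.rangeRestrict_surjective _⟩
  let η : 𝒜 0 →+* R := (e.symm : _ →+* R).comp (θ.hom.codRestrict (algebraMap R K).range hr)
  have hη : (algebraMap R K).comp η = θ.hom := by
    ext a
    have : ((e (e.symm (θ.hom.codRestrict (algebraMap R K).range hr a)) : (algebraMap R K).range) : K) =
      θ.hom a := by rw [RingEquiv.apply_symm_apply]; rfl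
    exact this
  have hsq : CommSq y (Spec.map (CommRingCat.ofHom (algebraMap R K))) (i ≫ q)
      (Spec.map (CommRingCat.ofHom η)) := by
    constructor
    rw [← hθ, ← Spec.map_comp]
    congr 1
    ext1
    exact hη.symm
  obtain ⟨⟨l, h1, h2⟩⟩ := hp.1 ⟨R, K, y, Spec.map (CommRingCat.ofHom η), hsq⟩
  exact ⟨l, h1⟩

theorem proper_stalk {X Y : Scheme.{0}} [IsIntegral X] {K : Type} [Field K]
    (φ : X.functionField ≅ CommRingCat.of K) (hY : IsProjectiveComplexVariety Y) (x : X)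
    [IsDiscreteValuationRing (X.presheaf.stalk x)] (y : Spec (.of K) ⟶ Y) :
    ∃ p : Spec (X.presheaf.stalk x) ⟶ Y, Spec.map (toK φ x) ≫ p = y := by
  let _ := (toK φ x).hom.toAlgebra
  have := toK_isFractionRing φ x
  exact valuative_proj hY (R := X.presheaf.stalk x) y

end proper
end BirProof

namespace BirProof
section smooth
open AlgebraicGeometry (IsIntegral)

variable {k : Type} [Field k] (X : Scheme.{0}) [X.Over (Spec (CommRingCat.of k))] [IsIntegral X]

theorem secHom_eq (W : X.Opens) : secHom (CommRingCat.of k) X W =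
    ((Scheme.ΓSpecIso (CommRingCat.of k)).inv ≫
      (X ↘ Spec (CommRingCat.of k)).appLE ⊤ W (by simp)).hom := rfl

theorem secHom_res {W V : X.Opens} (h : V ≤ W) : secHom (CommRingCat.of k) X V =
    (X.presheaf.map (homOfLE h).op).hom.comp (secHom (CommRingCat.of k) X W) := by
  have := Scheme.Hom.appLE_map (X ↘ Spec (CommRingCat.of k)) (U := ⊤) (V := W) (by simp) (homOfLE h).op
  exact congrArg (fun t => ((Scheme.ΓSpecIso (CommRingCat.of k)).inv ≫ t).hom) this.symm

/-- a good affine open -/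
def Good (n : ℕ) (W : X.Opens) : Prop :=
  letI := secAlgebra (CommRingCat.of k) X W
  Algebra.Smooth (CommRingCat.of k) Γ(X, W) ∧
    Nonempty (Module.Basis (Fin n) Γ(X, W) (Ω[Γ(X, W)⁄(CommRingCat.of k)]))

theorem secHom_smooth [Smooth (X ↘ Spec (CommRingCat.of k))] {W : X.Opens} (hW : IsAffineOpen W) :
    (secHom (CommRingCat.of k) X W).Smooth := by
  rw [secHom_eq, CommRingCat.hom_comp]
  have h1 := (X ↘ Spec (CommRingCat.of k)).smooth_appLE (isAffineOpen_top _) hW (by simp)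
  exact RingHom.Smooth.comp (RingHom.Smooth.of_bijective 
    (ConcreteCategory.bijective_of_isIso (Scheme.ΓSpecIso (CommRingCat.of k)).inv)) h1

theorem exists_good (n : ℕ) [SmoothOfRelativeDimension n (X ↘ Spec (CommRingCat.of k))] (O : X.Opens)
    (x : X) (hx : x ∈ O) : ∃ W : X.Opens, W ≤ O ∧ x ∈ W ∧ IsAffineOpen W ∧ Good (k := k) X n W := by
  obtain ⟨U, hU, V, hV, hxV, e, h⟩ :=
    SmoothOfRelativeDimension.exists_isStandardSmoothOfRelativeDimension (n := n)
      (f := X ↘ Spec (CommRingCat.of k)) x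
  have hUtop : U = ⊤ := by
    have hs : Subsingleton (Spec (CommRingCat.of k)) := inferInstanceAs (Subsingleton (PrimeSpectrum k))
    rw [eq_top_iff]
    intro z _
    rw [Subsingleton.elim z ((X ↘ Spec (CommRingCat.of k)) x)]
    exact e hxV
  subst hUtop
  obtain ⟨f, hf1, hxf⟩ := hV.exists_basicOpen_le ⟨x, hx⟩ hxV
  have hle : X.basicOpen f ≤ V := X.basicOpen_le f
  have := SmoothOfRelativeDimension.smooth n (X ↘ Spec (CommRingCat.of k))
  have haff := hV.basicOpen f
  refine ⟨X.basicOpen f, hf1, hxf, haff, secHom_smooth X haff, ?_⟩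
  let _ := secAlgebra (CommRingCat.of k) X V
  let _ := secAlgebra (CommRingCat.of k) X (X.basicOpen f)
  have hst : Algebra.IsStandardSmoothOfRelativeDimension n (CommRingCat.of k) Γ(X, V) := by
    have : (secHom (CommRingCat.of k) X V).IsStandardSmoothOfRelativeDimension n := by
      rw [secHom_eq, CommRingCat.hom_comp]
      have h2 := RingHom.isStandardSmoothOfRelativeDimension_respectsIso (n := n)
      exact h2.2 _ (Scheme.ΓSpecIso (CommRingCat.of k)).symm.commRingCatIsoToRingEquiv h
    exact this
  have hne : Nonempty V := ⟨⟨x, hxV⟩⟩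
  have hst' : Algebra.IsStandardSmooth (CommRingCat.of k) Γ(X, V) :=
    Algebra.IsStandardSmoothOfRelativeDimension.isStandardSmooth n
  have hr := Algebra.IsStandardSmoothOfRelativeDimension.rank_kaehlerDifferential
    (R := CommRingCat.of k) (S := Γ(X, V)) n
  have hfree : Module.Free Γ(X, V) (Ω[Γ(X, V)⁄(CommRingCat.of k)]) := inferInstance
  have b : Module.Basis (Fin n) Γ(X, V) (Ω[Γ(X, V)⁄(CommRingCat.of k)]) :=
    Module.finBasisOfFinrankEq _ _ (Module.finrank_eq_of_rank_eq hr)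
  let _ : Algebra Γ(X, V) Γ(X, X.basicOpen f) := (X.presheaf.map (homOfLE hle).op).hom.toAlgebra
  have hloc : IsLocalization.Away f Γ(X, X.basicOpen f) := hV.isLocalization_basicOpen f
  have htow : IsScalarTower (CommRingCat.of k) Γ(X, V) Γ(X, X.basicOpen f) :=
    IsScalarTower.of_algebraMap_eq' (secHom_res X hle)
  exact ⟨Module.Basis.ofIsLocalizedModule Γ(X, X.basicOpen f) (Submonoid.powers f)
    (KaehlerDifferential.map (CommRingCat.of k) (CommRingCat.of k) Γ(X, V) Γ(X, X.basicOpen f)) b⟩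

theorem stalk_facts [Smooth (X ↘ Spec (CommRingCat.of k))] (x : X) :
    IsNoetherianRing (X.presheaf.stalk x) ∧ IsIntegrallyClosed (X.presheaf.stalk x) := by
  obtain ⟨_, ⟨W, hW, rfl⟩, hxW, -⟩ :=
    X.isBasis_affineOpens.exists_subset_of_mem_open (Set.mem_univ x) isOpen_univ
  let _ := secAlgebra (CommRingCat.of k) X W
  have hne : Nonempty W := ⟨⟨x, hxW⟩⟩
  have hs : Algebra.Smooth (CommRingCat.of k) Γ(X, W) := secHom_smooth X hW
  let _ : Algebra Γ(X, W) (X.presheaf.stalk x) := (X.presheaf.germ W x hxW).hom.toAlgebra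
  have hloc : IsLocalization.AtPrime (X.presheaf.stalk x) (hW.primeIdealOf ⟨x, hxW⟩).asIdeal :=
    hW.isLocalization_stalk ⟨x, hxW⟩
  have hft : Algebra.FiniteType (CommRingCat.of k) Γ(X, W) := inferInstance
  have hnoeth : IsNoetherianRing Γ(X, W) :=
    Algebra.FiniteType.isNoetherianRing (CommRingCat.of k) _
  exact ⟨IsLocalization.isNoetherianRing (hW.primeIdealOf ⟨x, hxW⟩).asIdeal.primeCompl _ hnoeth,
    isIntegrallyClosed_localization_of_smooth (k := k) (hW.primeIdealOf ⟨x, hxW⟩).asIdeal _⟩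

/-- prime of a generization -/
noncomputable def primeAt {x y : X} (h : y ⤳ x) : PrimeSpectrum (X.presheaf.stalk x) :=
  PrimeSpectrum.comap (X.presheaf.stalkSpecializes h).hom (IsLocalRing.closedPoint (X.presheaf.stalk y))

theorem mem_primeAt {x y : X} (h : y ⤳ x) (s : X.presheaf.stalk x) :
    s ∈ (primeAt X h).asIdeal ↔ ¬ IsUnit ((X.presheaf.stalkSpecializes h).hom s) := by
  change (X.presheaf.stalkSpecializes h).hom s ∈ IsLocalRing.maximalIdeal (X.presheaf.stalk y) ↔ _
  rw [IsLocalRing.mem_maximalIdeal]; rfl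

theorem fromSpecStalk_primeAt {x y : X} (h : y ⤳ x) : X.fromSpecStalk x (primeAt X h) = y := by
  have h1 := Scheme.SpecMap_stalkSpecializes_fromSpecStalk h
  have h2 : (Spec.map (X.presheaf.stalkSpecializes h) ≫ X.fromSpecStalk x)
      (IsLocalRing.closedPoint (X.presheaf.stalk y)) = y := by
    rw [h1]
    exact Scheme.fromSpecStalk_closedPoint
  exact h2

theorem exists_point_of_prime (x : X) (p : PrimeSpectrum (X.presheaf.stalk x)) :
    ∃ (y : X) (h : y ⤳ x), p = primeAt X h := by
  have hy : X.fromSpecStalk x p ⤳ x := by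
    have : X.fromSpecStalk x p ∈ Set.range (X.fromSpecStalk x) := ⟨p, rfl⟩
    rw [Scheme.range_fromSpecStalk] at this
    exact this
  exact ⟨X.fromSpecStalk x p, hy,
    (X.fromSpecStalk x).isEmbedding.injective (fromSpecStalk_primeAt X hy).symm⟩

theorem primeAt_mono {x y z : X} (h : y ⤳ x) (h' : z ⤳ y) :
    (primeAt X (h'.trans h)).asIdeal ≤ (primeAt X h).asIdeal := by
  intro s hs
  rw [mem_primeAt] at hs ⊢
  intro hu
  apply hs
  have := hu.map (X.presheaf.stalkSpecializes h').hom
  rw [← TopCat.Presheaf.stalkSpecializes_comp _ h' h]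
  exact this

theorem primeAt_generic (x : X) : (primeAt X (genericPoint_specializes x)).asIdeal = ⊥ := by
  rw [eq_bot_iff]
  intro s hs
  rw [mem_primeAt] at hs
  have h1 : (X.presheaf.stalkSpecializes (genericPoint_specializes x)).hom s = 0 := by
    by_contra h0
    exact hs (IsUnit.mk0 (G₀ := X.functionField) _ h0)
  have h2 : Function.Injective (algebraMap (X.presheaf.stalk x) X.functionField) :=
    IsFractionRing.injective _ _
  exact h2 (h1.trans (map_zero _).symm)

theorem primeAt_self (x : X) : (primeAt X (specializes_refl x)).asIdeal =
    IsLocalRing.maximalIdeal (X.presheaf.stalk x) := by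
  ext s
  rw [mem_primeAt, IsLocalRing.mem_maximalIdeal, TopCat.Presheaf.stalkSpecializes_refl]
  rfl

theorem stalk_dvr [Smooth (X ↘ Spec (CommRingCat.of k))] (x : X) (hx : x ≠ genericPoint X)
    (h : ∀ y : X, y ⤳ x → y ≠ x → y = genericPoint X) :
    IsDiscreteValuationRing (X.presheaf.stalk x) := by
  obtain ⟨h1, h2⟩ := stalk_facts (k := k) X x
  have hmax : IsLocalRing.maximalIdeal (X.presheaf.stalk x) ≠ ⊥ := by
    intro h0
    rw [← primeAt_self, ← primeAt_generic] at h0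
    apply hx
    rw [← fromSpecStalk_primeAt X (specializes_refl x), PrimeSpectrum.ext h0, fromSpecStalk_primeAt]
  have := (tfae_of_isNoetherianRing_of_isLocalRing_of_isDomain (X.presheaf.stalk x)).out 3 0
  have hpir := this.mp ⟨h2, fun P hP hP' => by
    obtain ⟨y, hy, e⟩ := exists_point_of_prime X x ⟨P, hP'⟩
    by_cases hyx : y = x
    · subst hyx
      rw [← primeAt_self, ← e]
    · have := h y hy hyx
      subst this
      exact absurd ((congrArg PrimeSpectrum.asIdeal e).trans (primeAt_generic X x)) hP⟩
  exact { hpir with not_a_field' := hmax }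

theorem mem_stalk_of_codim_one [Smooth (X ↘ Spec (CommRingCat.of k))] {K : Type} [Field K]
    (φ : X.functionField ≅ CommRingCat.of K) (c : K) (x : X)
    (h : ∀ y : X, y ⤳ x → y ≠ genericPoint X → (∀ z : X, z ⤳ y → z ≠ y → z = genericPoint X) →
      c ∈ (toK φ y).hom.range) : c ∈ (toK φ x).hom.range := by
  let _ := (toK φ x).hom.toAlgebra
  have := toK_isFractionRing φ x
  obtain ⟨h1, h2⟩ := stalk_facts (k := k) X x
  refine hartogs (R := X.presheaf.stalk x) c ?_
  intro p hp hp0 hmin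
  obtain ⟨y, hy, e⟩ := exists_point_of_prime X x ⟨p, hp⟩
  have e' : p = (primeAt X hy).asIdeal := congrArg PrimeSpectrum.asIdeal e
  have hygen : y ≠ genericPoint X := by
    rintro rfl
    exact hp0 (e'.trans (primeAt_generic X x))
  obtain ⟨t, ht⟩ := h y hy hygen (fun z hz hzy => by
    have hle : (primeAt X (hz.trans hy)).asIdeal ≤ p := e' ▸ primeAt_mono X hy hz
    have hne : (primeAt X (hz.trans hy)).asIdeal ≠ p := by
      intro h0
      apply hzy
      rw [← fromSpecStalk_primeAt X (hz.trans hy), PrimeSpectrum.ext (h0.trans e'), fromSpecStalk_primeAt]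
    have hbot := hmin _ (primeAt X (hz.trans hy)).isPrime (lt_of_le_of_ne hle hne)
    rw [← primeAt_generic] at hbot
    rw [← fromSpecStalk_primeAt X (hz.trans hy), PrimeSpectrum.ext hbot, fromSpecStalk_primeAt])
  obtain ⟨_, ⟨W, hW, rfl⟩, hxW, -⟩ :=
    X.isBasis_affineOpens.exists_subset_of_mem_open (Set.mem_univ x) isOpen_univ
  have hyW : y ∈ W := hy.mem_open W.2 hxW
  let _ : Algebra Γ(X, W) (X.presheaf.stalk y) := (X.presheaf.germ W y hyW).hom.toAlgebra
  have hloc : IsLocalization.AtPrime (X.presheaf.stalk y) (hW.primeIdealOf ⟨y, hyW⟩).asIdeal :=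
    hW.isLocalization_stalk ⟨y, hyW⟩
  obtain ⟨⟨r, s⟩, hrs⟩ := IsLocalization.surj (hW.primeIdealOf ⟨y, hyW⟩).asIdeal.primeCompl t
  have hsp : ∀ a : Γ(X, W), (X.presheaf.stalkSpecializes hy).hom ((X.presheaf.germ W x hxW).hom a) =
      (X.presheaf.germ W y hyW).hom a := by
    intro a
    rw [← TopCat.Presheaf.germ_stalkSpecializes X.presheaf hxW hy]; rfl
  have hK : ∀ b : X.presheaf.stalk x, (toK φ x).hom b =
      (toK φ y).hom ((X.presheaf.stalkSpecializes hy).hom b) := by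
    intro b
    rw [toK, ← TopCat.Presheaf.stalkSpecializes_comp _ (genericPoint_specializes y) hy]; rfl
  refine ⟨(X.presheaf.germ W x hxW).hom s, ?_, (X.presheaf.germ W x hxW).hom r, ?_⟩
  · rw [e', mem_primeAt, not_not, hsp]
    exact IsLocalization.map_units (X.presheaf.stalk y) s
  · change (toK φ x).hom _ * c = (toK φ x).hom _
    rw [hK, hK, hsp, hsp, ← ht, ← map_mul, mul_comm]
    exact congrArg _ hrs

end smooth
end BirProof

namespace BirProof
section forms
open AlgebraicGeometry (IsIntegral)
variable {X Y : Scheme.{0}} [IsIntegral X] [IsIntegral Y] {K : Type} [Field K]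

theorem le_preimage_gpt (φ : X.functionField ≅ CommRingCat.of K) (W : X.Opens)
    (h : genericPoint X ∈ W) : (⊤ : (Spec (CommRingCat.of K)).Opens) ≤ gpt φ ⁻¹ᵁ W := by
  intro p _
  change gpt φ p ∈ W
  rw [gpt_apply]; exact h

/-- sections into the function field -/
noncomputable def secK (φ : X.functionField ≅ CommRingCat.of K) (W : X.Opens)
    (h : genericPoint X ∈ W) : Γ(X, W) ⟶ CommRingCat.of K :=
  (gpt φ).appLE W ⊤ (le_preimage_gpt φ W h) ≫ (Scheme.ΓSpecIso _).hom

theorem secK_germ (φ : X.functionField ≅ CommRingCat.of K) (W : X.Opens)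
    (h : genericPoint X ∈ W) (x : X) (hx : x ∈ W) :
    secK φ W h = X.presheaf.germ W x hx ≫ toK φ x := by
  have h1 : secK φ W h = X.presheaf.germ W _ h ≫ φ.hom := by
    have e : (⊤ : (Spec X.functionField).Opens) ≤ X.fromSpecStalk (genericPoint X) ⁻¹ᵁ W := by
      intro p _
      have hp : X.fromSpecStalk (genericPoint X) p ∈ Set.range (X.fromSpecStalk (genericPoint X)) :=
        ⟨_, rfl⟩
      rw [Scheme.range_fromSpecStalk] at hp
      have h2 : X.fromSpecStalk (genericPoint X) p = genericPoint X :=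
        (hp.antisymm (genericPoint_specializes _)).eq
      change X.fromSpecStalk (genericPoint X) p ∈ W
      rw [h2]; exact h
    have := Scheme.Hom.appLE_comp_appLE (Spec.map φ.hom) (X.fromSpecStalk (genericPoint X)) W ⊤ ⊤ e le_top
    rw [secK]
    change ((Spec.map φ.hom ≫ X.fromSpecStalk (genericPoint X)).appLE W ⊤ _) ≫ _ = _
    rw [← this]
    have h2 : (X.fromSpecStalk (genericPoint X)).appLE W ⊤ e = X.presheaf.germ W _ h ≫
        (Scheme.ΓSpecIso _).inv := by
      rw [Scheme.Hom.appLE, Scheme.fromSpecStalk_app h, Category.assoc, Category.assoc]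
      congr 1
    rw [h2]
    have h3 := Scheme.ΓSpecIso_naturality φ.hom
    have h4 : (Spec.map φ.hom).appLE ⊤ ⊤ le_top = (Spec.map φ.hom).appTop :=
      Scheme.Hom.appLE_eq_app _
    have h5 : (Spec.map φ.hom).appLE ⊤ ⊤ le_top ≫ (Scheme.ΓSpecIso _).hom =
      (Scheme.ΓSpecIso _).hom ≫ φ.hom := by rw [← h3]; exact congrArg (· ≫ _) h4
    rw [Category.assoc, Category.assoc]
    refine congrArg (X.presheaf.germ W _ h ≫ ·) ?_
    exact (congrArg ((Scheme.ΓSpecIso _).inv ≫ ·) h5).trans (Iso.inv_hom_id_assoc _ _)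
  rw [h1, toK, ← Category.assoc, TopCat.Presheaf.germ_stalkSpecializes]

theorem secK_res (φ : X.functionField ≅ CommRingCat.of K) {W V : X.Opens} (hVW : V ≤ W)
    (h : genericPoint X ∈ V) :
    X.presheaf.map (homOfLE hVW).op ≫ secK φ V h = secK φ W (hVW h) := by
  rw [secK, secK, ← Category.assoc, Scheme.Hom.map_appLE]

theorem secK_isFractionRing (φ : X.functionField ≅ CommRingCat.of K) (W : X.Opens)
    (h : genericPoint X ∈ W) (hW : IsAffineOpen W) :
    @IsFractionRing Γ(X, W) _ K _ (secK φ W h).hom.toAlgebra := by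
  let _ := (secK φ W h).hom.toAlgebra
  have : Nonempty W := ⟨⟨_, h⟩⟩
  have := functionField_isFractionRing_of_isAffineOpen X W hW
  let e : X.functionField ≃ₐ[Γ(X, W)] K :=
    { φ.commRingCatIsoToRingEquiv with
      commutes' := fun r => by
        have h1 := secK_germ φ W h _ h
        have : toK φ (genericPoint X) = φ.hom := by simp [toK]
        rw [this] at h1
        exact congrArg (fun t => t.hom r) h1.symm }
  exact IsLocalization.isLocalization_of_algEquiv _ e

theorem secK_injective (φ : X.functionField ≅ CommRingCat.of K) (W : X.Opens)
    (h : genericPoint X ∈ W) (hW : IsAffineOpen W) :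
    Function.Injective (secK φ W h).hom := by
  let _ := (secK φ W h).hom.toAlgebra
  have := secK_isFractionRing φ W h hW
  exact IsFractionRing.injective Γ(X, W) K

variable {k : Type} [Field k] [Algebra k K]

theorem secK_secHom [X.Over (Spec (CommRingCat.of k))] (φ : X.functionField ≅ CommRingCat.of K)
    (hφ : gpt φ ≫ (X ↘ Spec (CommRingCat.of k)) = Spec.map (CommRingCat.ofHom (algebraMap k K)))
    (W : X.Opens) (h : genericPoint X ∈ W) :
    (secK φ W h).hom.comp (secHom (CommRingCat.of k) X W) = algebraMap k K := by
  have := Scheme.Hom.appLE_comp_appLE (gpt φ) (X ↘ Spec (CommRingCat.of k)) ⊤ W ⊤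
    (by simp) (le_preimage_gpt φ W h)
  rw [secHom_eq, ← CommRingCat.hom_comp, secK, Category.assoc]
  rw [reassoc_of% this]
  have h2 : (gpt φ ≫ (X ↘ Spec (CommRingCat.of k))).appLE ⊤ ⊤ (by simp) =
    (Spec.map (CommRingCat.ofHom (algebraMap k K))).appLE ⊤ ⊤ (by simp) := by
    congr 1
  rw [h2]
  have h3 := Scheme.ΓSpecIso_naturality (CommRingCat.ofHom (algebraMap k K))
  have h4 : (Spec.map (CommRingCat.ofHom (algebraMap k K))).appLE ⊤ ⊤ (by simp) =
    (Spec.map (CommRingCat.ofHom (algebraMap k K))).appTop := Scheme.Hom.appLE_eq_app _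
  have h5 := (congrArg (· ≫ (Scheme.ΓSpecIso (CommRingCat.of K)).hom) h4).trans h3
  exact congrArg CommRingCat.Hom.hom ((congrArg ((Scheme.ΓSpecIso _).inv ≫ ·) h5).trans
    (Iso.inv_hom_id_assoc _ _))

/-- spreading out the morphism to sections -/
theorem exists_secmap (φ : X.functionField ≅ CommRingCat.of K) (ψ : Y.functionField ≅ CommRingCat.of K)
    (U : X.Opens) (F : U.toScheme ⟶ Y) (hU : genericPoint X ∈ U) 
    (hF : ∀ g : Spec (.of K) ⟶ U.toScheme, g ≫ U.ι = gpt φ → g ≫ F = gpt ψ)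
    (V : Y.Opens) (W : X.Opens) (hV : genericPoint Y ∈ V) (hW : genericPoint X ∈ W) 
    (hWV : W ≤ (Scheme.Hom.opensFunctor U.ι).obj (F ⁻¹ᵁ V)) :
    ∃ r : Γ(Y, V) ⟶ Γ(X, W), r ≫ secK φ W hW = secK ψ V hV := by
  obtain ⟨g, hg⟩ := exists_lift φ U hU
  have hWU : W ≤ U.ι.opensRange := hWV.trans (by simpa using U.ι.image_le_opensRange _)
  have hiso : IsIso (U.ι.app W) := U.ι.isIso_app W hWU
  have e1 : U.ι ⁻¹ᵁ W ≤ F ⁻¹ᵁ V := by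
    intro z hz
    obtain ⟨z', hz', h⟩ := hWV hz
    have : z' = z := U.ι.isOpenEmbedding.injective h
    exact this ▸ hz'
  have e2 : (⊤ : (Spec (CommRingCat.of K)).Opens) ≤ g ⁻¹ᵁ (U.ι ⁻¹ᵁ W) := by
    rw [← Scheme.Hom.comp_preimage, hg]; exact le_preimage_gpt φ W hW
  refine ⟨F.appLE V (U.ι ⁻¹ᵁ W) e1 ≫ inv (U.ι.app W), ?_⟩
  have h1 : secK φ W hW = U.ι.app W ≫ g.appLE (U.ι ⁻¹ᵁ W) ⊤ e2 ≫ (Scheme.ΓSpecIso _).hom := by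
    rw [secK, ← Category.assoc]
    congr 1
    have := Scheme.Hom.appLE_comp_appLE g U.ι W (U.ι ⁻¹ᵁ W) ⊤ le_rfl e2
    rw [Scheme.Hom.appLE_eq_app] at this
    rw [this]; congr 1; exact hg.symm
  have h2 : secK ψ V hV = F.appLE V (U.ι ⁻¹ᵁ W) e1 ≫ g.appLE (U.ι ⁻¹ᵁ W) ⊤ e2 ≫ (Scheme.ΓSpecIso _).hom := by
    rw [secK, ← Category.assoc]
    congr 1
    have := Scheme.Hom.appLE_comp_appLE g F V (U.ι ⁻¹ᵁ W) ⊤ e1 e2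
    rw [this]; congr 1; exact (hF g hg).symm
  rw [h1, h2, Category.assoc, IsIso.inv_hom_id_assoc]

end forms
end BirProof

namespace BirProof
section forms2
open AlgebraicGeometry (IsIntegral)
variable {X Y : Scheme.{0}} [IsIntegral X] [IsIntegral Y] {K : Type} [Field K]
variable {k : Type} [Field k] [Algebra k K]
variable [X.Over (Spec (CommRingCat.of k))] [Y.Over (Spec (CommRingCat.of k))]

/-- forms on an open set, as forms on the function field -/
noncomputable def omK (φ : X.functionField ≅ CommRingCat.of K)
    (hφ : gpt φ ≫ (X ↘ Spec (CommRingCat.of k)) = Spec.map (CommRingCat.ofHom (algebraMap k K)))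
    (W : X.Opens) (h : genericPoint X ∈ W) (w : FormsOn (CommRingCat.of k) X W) :
    ExteriorAlgebra K (Ω[K⁄(CommRingCat.of k)]) :=
  letI := secAlgebra (CommRingCat.of k) X W
  letI := (secK φ W h).hom.toAlgebra
  haveI : IsScalarTower (CommRingCat.of k) Γ(X, W) K :=
    IsScalarTower.of_algebraMap_eq' (secK_secHom φ hφ W h).symm
  ftHom (CommRingCat.of k) Γ(X, W) K w

theorem omK_compat (φ : X.functionField ≅ CommRingCat.of K)
    (hφ : gpt φ ≫ (X ↘ Spec (CommRingCat.of k)) = Spec.map (CommRingCat.ofHom (algebraMap k K)))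
    {n : ℕ} (ω : GaugeForm (CommRingCat.of k) X n) (W V : X.Opens) (hW : IsAffineOpen W) (hV : IsAffineOpen V)
    (e : V ≤ W) (h : genericPoint X ∈ V) :
    omK φ hφ V h (ω.form V hV) = omK φ hφ W (e h) (ω.form W hW) := by
  rw [← ω.compat W V hW hV e]
  let _ := secAlgebra (CommRingCat.of k) X W
  let _ := secAlgebra (CommRingCat.of k) X V
  let _ := (secK φ W (e h)).hom.toAlgebra
  let _ := (secK φ V h).hom.toAlgebra
  have : IsScalarTower (CommRingCat.of k) Γ(X, W) K :=
    IsScalarTower.of_algebraMap_eq' (secK_secHom φ hφ W (e h)).symm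
  have : IsScalarTower (CommRingCat.of k) Γ(X, V) K :=
    IsScalarTower.of_algebraMap_eq' (secK_secHom φ hφ V h).symm
  have happ : (𝟙 X : X ⟶ X).appLE W V (by simpa using e) = X.presheaf.map (homOfLE e).op := by
    simp [Scheme.Hom.appLE]
    exact Category.id_comp _
  let _ : Algebra Γ(X, W) Γ(X, V) := ((𝟙 X : X ⟶ X).appLE W V (by simpa using e)).hom.toAlgebra
  have : IsScalarTower Γ(X, W) Γ(X, V) K := IsScalarTower.of_algebraMap_eq' (by
    change _ = (secK φ V h).hom.comp ((𝟙 X : X ⟶ X).appLE W V (by simpa using e)).hom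
    rw [happ]
    exact congrArg CommRingCat.Hom.hom (secK_res φ e h).symm)
  have : IsScalarTower (CommRingCat.of k) Γ(X, W) Γ(X, V) := IsScalarTower.of_algebraMap_eq' (by
    change secHom _ X V = ((𝟙 X : X ⟶ X).appLE W V (by simpa using e)).hom.comp (secHom _ X W)
    rw [happ]
    exact secHom_res X e)
  have h1 : formPullback (CommRingCat.of k) (𝟙 X) (Category.id_comp _) W V (by simpa using e) (ω.form W hW) =
    ftHom (CommRingCat.of k) Γ(X, W) Γ(X, V) (ω.form W hW) :=
    formTransfer_eq (CommRingCat.of k) Γ(X, W) Γ(X, V) (ω.form W hW)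
  rw [h1]
  exact ftHom_comp (CommRingCat.of k) Γ(X, W) Γ(X, V) K (ω.form W hW)

theorem omK_eq (φ : X.functionField ≅ CommRingCat.of K)
    (hφ : gpt φ ≫ (X ↘ Spec (CommRingCat.of k)) = Spec.map (CommRingCat.ofHom (algebraMap k K)))
    {n : ℕ} (ω : GaugeForm (CommRingCat.of k) X n) (W V : X.Opens) (hW : IsAffineOpen W) (hV : IsAffineOpen V)
    (h : genericPoint X ∈ V) (h' : genericPoint X ∈ W) :
    omK φ hφ V h (ω.form V hV) = omK φ hφ W h' (ω.form W hW) := by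
  obtain ⟨_, ⟨T, hT, rfl⟩, hxT, hTV⟩ :=
    X.isBasis_affineOpens.exists_subset_of_mem_open (show genericPoint X ∈ V ⊓ W from ⟨h, h'⟩) (V ⊓ W).2
  rw [← omK_compat φ hφ ω V T hV hT (fun z hz => (hTV hz).1) hxT,
    ← omK_compat φ hφ ω W T hW hT (fun z hz => (hTV hz).2) hxT]

theorem omK_ne_zero (φ : X.functionField ≅ CommRingCat.of K)
    (hφ : gpt φ ≫ (X ↘ Spec (CommRingCat.of k)) = Spec.map (CommRingCat.ofHom (algebraMap k K)))
    {n : ℕ} (ω : GaugeForm (CommRingCat.of k) X n) (W : X.Opens) (hW : IsAffineOpen W)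
    (hG : Good (k := k) X n W)
    (h : genericPoint X ∈ W) : omK φ hφ W h (ω.form W hW) ≠ 0 := by
  let _ := secAlgebra (CommRingCat.of k) X W
  let _ := (secK φ W h).hom.toAlgebra
  have : IsScalarTower (CommRingCat.of k) Γ(X, W) K :=
    IsScalarTower.of_algebraMap_eq' (secK_secHom φ hφ W h).symm
  have := secK_isFractionRing φ W h hW
  have : Nonempty W := ⟨⟨_, h⟩⟩
  obtain ⟨-, ⟨b⟩⟩ := hG
  exact ftHom_ne_zero b (ω.form W hW) (ω.generates W hW)

theorem omK_coeff (φ : X.functionField ≅ CommRingCat.of K)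
    (hφ : gpt φ ≫ (X ↘ Spec (CommRingCat.of k)) = Spec.map (CommRingCat.ofHom (algebraMap k K)))
    (ψ : Y.functionField ≅ CommRingCat.of K)
    (hψ : gpt ψ ≫ (Y ↘ Spec (CommRingCat.of k)) = Spec.map (CommRingCat.ofHom (algebraMap k K)))
    {n : ℕ} (ω : GaugeForm (CommRingCat.of k) X n) (η : GaugeForm (CommRingCat.of k) Y n)
    (W : X.Opens) (hW : IsAffineOpen W) (h : genericPoint X ∈ W)
    (V : Y.Opens) (hV : IsAffineOpen V) (h' : genericPoint Y ∈ V)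
    (r : Γ(Y, V) ⟶ Γ(X, W)) (hr : r ≫ secK φ W h = secK ψ V h') :
    ∃ b : Γ(X, W), omK ψ hψ V h' (η.form V hV) =
        (show K from (secK φ W h).hom b) • omK φ hφ W h (ω.form W hW) ∧
      (Good (k := k) X n W → Good (k := k) Y n V → IsUnit b → r.hom.Flat) := by
  let _ := secAlgebra (CommRingCat.of k) X W
  let _ := secAlgebra (CommRingCat.of k) Y V
  let _ := (secK φ W h).hom.toAlgebra
  let _ := (secK ψ V h').hom.toAlgebra
  let _ : Algebra Γ(Y, V) Γ(X, W) := r.hom.toAlgebra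
  have : IsScalarTower (CommRingCat.of k) Γ(X, W) K :=
    IsScalarTower.of_algebraMap_eq' (secK_secHom φ hφ W h).symm
  have : IsScalarTower (CommRingCat.of k) Γ(Y, V) K :=
    IsScalarTower.of_algebraMap_eq' (secK_secHom ψ hψ V h').symm
  have hr' : (secK ψ V h').hom = (secK φ W h).hom.comp r.hom := congrArg CommRingCat.Hom.hom hr.symm
  have : IsScalarTower Γ(Y, V) Γ(X, W) K := IsScalarTower.of_algebraMap_eq' hr'
  have : IsScalarTower (CommRingCat.of k) Γ(Y, V) Γ(X, W) := IsScalarTower.of_algebraMap_eq' (by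
    change secHom _ X W = r.hom.comp (secHom _ Y V)
    have h1 := secK_secHom φ hφ W h
    rw [← secK_secHom ψ hψ V h', hr', RingHom.comp_assoc] at h1
    ext t
    exact secK_injective φ W h hW (RingHom.congr_fun h1 t))
  obtain ⟨b, hb1, hb2⟩ := exists_coeff (R := (CommRingCat.of k)) (A := Γ(Y, V)) (B := Γ(X, W)) (K := K)
    (η.form V hV) (ω.form W hW) (η.isDegree V hV) (ω.generates W hW)
  refine ⟨b, hb2, ?_⟩
  rintro ⟨hs1, ⟨b1⟩⟩ ⟨hs2, ⟨b2⟩⟩ hu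
  have := etale_of_generates b2 b1 (η.form V hV) (ω.form W hW) (η.isDegree V hV) (ω.generates W hW) b hu hb1
  have : Module.Flat Γ(Y, V) Γ(X, W) := inferInstance
  exact this

end forms2
end BirProof

namespace BirProof
section loc
open AlgebraicGeometry (IsIntegral)
variable {X Y : Scheme.{0}} [IsIntegral X] [IsIntegral Y] {K : Type} [Field K]
variable {k : Type} [Field k] [Algebra k K]
variable [X.Over (Spec (CommRingCat.of k))] [Y.Over (Spec (CommRingCat.of k))]

theorem generic_mem (W : X.Opens) (x : X) (hx : x ∈ W) : genericPoint X ∈ W :=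
  (genericPoint_specializes x).mem_open W.2 hx

theorem smul_cancel_ext {M : Type} [AddCommGroup M] [Module K M] {a c : K} {v : M} (hv : v ≠ 0)
    (h : a • v = c • v) : a = c := smul_left_injective K hv h

/-- the local comparison homomorphism -/
theorem exists_stalk_hom (φ : X.functionField ≅ CommRingCat.of K) (ψ : Y.functionField ≅ CommRingCat.of K)
    (U : X.Opens) (F : U.toScheme ⟶ Y)
    (hF : ∀ g : Spec (.of K) ⟶ U.toScheme, g ≫ U.ι = gpt φ → g ≫ F = gpt ψ)
    (x : X) (hx : x ∈ U) :
    ∃ s : Y.presheaf.stalk (F ⟨x, hx⟩) ⟶ X.presheaf.stalk x, IsLocalHom s.hom ∧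
      s ≫ toK φ x = toK ψ (F ⟨x, hx⟩) := by
  let p : Spec (X.presheaf.stalk x) ⟶ Y := U.fromSpecStalkOfMem x hx ≫ F
  have hp : Spec.map (toK φ x) ≫ p = gpt ψ := by
    rw [← hF (Spec.map (toK φ x) ≫ U.fromSpecStalkOfMem x hx)]
    · simp [p]
    · rw [Category.assoc, Scheme.Opens.fromSpecStalkOfMem_ι, toK_comp]
  have h1 : U.fromSpecStalkOfMem x hx (IsLocalRing.closedPoint (X.presheaf.stalk x)) = ⟨x, hx⟩ := by
    apply U.ι.isOpenEmbedding.injective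
    have h2 : (U.fromSpecStalkOfMem x hx ≫ U.ι) (IsLocalRing.closedPoint (X.presheaf.stalk x)) = x := by
      rw [Scheme.Opens.fromSpecStalkOfMem_ι]
      exact Scheme.fromSpecStalk_closedPoint
    exact h2
  have hy : p (IsLocalRing.closedPoint (X.presheaf.stalk x)) = F ⟨x, hx⟩ := by
    rw [← h1]; rfl
  rw [← hy]
  refine ⟨Scheme.stalkClosedPointTo p, inferInstance, ?_⟩
  apply Spec.map_injective
  rw [← cancel_mono (Y.fromSpecStalk _), toK_comp, Spec.map_comp, Category.assoc,
    Scheme.Spec_stalkClosedPointTo_fromSpecStalk, hp]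

theorem local_coeff
    (φ : X.functionField ≅ CommRingCat.of K)
    (hφ : gpt φ ≫ (X ↘ Spec (CommRingCat.of k)) = Spec.map (CommRingCat.ofHom (algebraMap k K)))
    (ψ : Y.functionField ≅ CommRingCat.of K)
    (hψ : gpt ψ ≫ (Y ↘ Spec (CommRingCat.of k)) = Spec.map (CommRingCat.ofHom (algebraMap k K)))
    {n : ℕ} (ω : GaugeForm (CommRingCat.of k) X n) (η : GaugeForm (CommRingCat.of k) Y n)
    [SmoothOfRelativeDimension n (X ↘ Spec (CommRingCat.of k))]
    [SmoothOfRelativeDimension n (Y ↘ Spec (CommRingCat.of k))]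
    (ΩX ΩY : ExteriorAlgebra K (Ω[K⁄(CommRingCat.of k)])) (hX0 : ΩX ≠ 0)
    (hX : ∀ W h hW, omK φ hφ W h (ω.form W hW) = ΩX)
    (hY : ∀ W h hW, omK ψ hψ W h (η.form W hW) = ΩY)
    (U : X.Opens) (F : U.toScheme ⟶ Y)
    (hF : ∀ g : Spec (.of K) ⟶ U.toScheme, g ≫ U.ι = gpt φ → g ≫ F = gpt ψ)
    (x : X) (hx : x ∈ U) (V : Y.Opens) (hV : IsAffineOpen V) (hxV : F ⟨x, hx⟩ ∈ V) (O : X.Opens)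
    (hxO : x ∈ O) :
    ∃ (W : X.Opens) (hxW : x ∈ W) (r : Γ(Y, V) ⟶ Γ(X, W)) (b : Γ(X, W)),
      W ≤ O ∧ IsAffineOpen W ∧ r ≫ secK φ W (generic_mem W x hxW) = secK ψ V (generic_mem V _ hxV) ∧
      ΩY = (show K from (secK φ W (generic_mem W x hxW)).hom b) • ΩX ∧
      (Good (k := k) Y n V → IsUnit b → r.hom.Flat) := by
  have hxm : x ∈ (Scheme.Hom.opensFunctor U.ι).obj (F ⁻¹ᵁ V) := ⟨⟨x, hx⟩, hxV, rfl⟩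
  obtain ⟨W, hWO, hxW, hW, hG⟩ := exists_good (k := k) X n ((Scheme.Hom.opensFunctor U.ι).obj (F ⁻¹ᵁ V) ⊓ O) x ⟨hxm, hxO⟩
  obtain ⟨r, hr⟩ := exists_secmap φ ψ U F (generic_mem U x hx) hF V W (generic_mem V _ hxV)
    (generic_mem W x hxW) (hWO.trans inf_le_left)
  obtain ⟨b, hb1, hb2⟩ := omK_coeff φ hφ ψ hψ ω η W hW (generic_mem W x hxW) V hV
    (generic_mem V _ hxV) r hr
  rw [hX, hY] at hb1
  exact ⟨W, hxW, r, b, hWO.trans inf_le_right, hW, hr, hb1, hb2 hG⟩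

theorem coeff_mem
    (φ : X.functionField ≅ CommRingCat.of K)
    (hφ : gpt φ ≫ (X ↘ Spec (CommRingCat.of k)) = Spec.map (CommRingCat.ofHom (algebraMap k K)))
    (ψ : Y.functionField ≅ CommRingCat.of K)
    (hψ : gpt ψ ≫ (Y ↘ Spec (CommRingCat.of k)) = Spec.map (CommRingCat.ofHom (algebraMap k K)))
    {n : ℕ} (ω : GaugeForm (CommRingCat.of k) X n) (η : GaugeForm (CommRingCat.of k) Y n)
    [SmoothOfRelativeDimension n (X ↘ Spec (CommRingCat.of k))]
    [SmoothOfRelativeDimension n (Y ↘ Spec (CommRingCat.of k))]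
    (ΩX ΩY : ExteriorAlgebra K (Ω[K⁄(CommRingCat.of k)])) (hX0 : ΩX ≠ 0)
    (hX : ∀ W h hW, omK φ hφ W h (ω.form W hW) = ΩX)
    (hY : ∀ W h hW, omK ψ hψ W h (η.form W hW) = ΩY)
    (c : K) (hc : ΩY = c • ΩX) (U : X.Opens) (F : U.toScheme ⟶ Y)
    (hF : ∀ g : Spec (.of K) ⟶ U.toScheme, g ≫ U.ι = gpt φ → g ≫ F = gpt ψ)
    (x : X) (hx : x ∈ U) : c ∈ (toK φ x).hom.range := by
  obtain ⟨V, -, hxV, hV, -⟩ := exists_good (k := k) Y n ⊤ (F ⟨x, hx⟩) trivial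
  obtain ⟨W, hxW, r, b, -, hW, hr, hb, -⟩ := local_coeff φ hφ ψ hψ ω η ΩX ΩY hX0 hX hY U F hF x hx V hV hxV ⊤ trivial
  rw [hc] at hb
  have := smul_cancel_ext (K := K) hX0 hb
  rw [secK_germ φ W _ x hxW] at this
  exact ⟨_, this.symm⟩

theorem exists_inverse_local
    (φ : X.functionField ≅ CommRingCat.of K)
    (hφ : gpt φ ≫ (X ↘ Spec (CommRingCat.of k)) = Spec.map (CommRingCat.ofHom (algebraMap k K)))
    (ψ : Y.functionField ≅ CommRingCat.of K)
    (hψ : gpt ψ ≫ (Y ↘ Spec (CommRingCat.of k)) = Spec.map (CommRingCat.ofHom (algebraMap k K)))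
    {n : ℕ} (ω : GaugeForm (CommRingCat.of k) X n) (η : GaugeForm (CommRingCat.of k) Y n)
    [SmoothOfRelativeDimension n (X ↘ Spec (CommRingCat.of k))]
    [SmoothOfRelativeDimension n (Y ↘ Spec (CommRingCat.of k))]
    (ΩX ΩY : ExteriorAlgebra K (Ω[K⁄(CommRingCat.of k)])) (hX0 : ΩX ≠ 0)
    (hX : ∀ W h hW, omK φ hφ W h (ω.form W hW) = ΩX)
    (hY : ∀ W h hW, omK ψ hψ W h (η.form W hW) = ΩY)
    (c : K) (hc0 : c ≠ 0) (hc : ΩY = c • ΩX) (U : X.Opens) (F : U.toScheme ⟶ Y)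
    (hF : ∀ g : Spec (.of K) ⟶ U.toScheme, g ≫ U.ι = gpt φ → g ≫ F = gpt ψ)
    (x : X) (hx : x ∈ U) (hcinv : c⁻¹ ∈ (toK ψ (F ⟨x, hx⟩)).hom.range) :
    ∃ q : Spec (Y.presheaf.stalk (F ⟨x, hx⟩)) ⟶ X, Spec.map (toK ψ (F ⟨x, hx⟩)) ≫ q = gpt φ := by
  obtain ⟨s, hsloc, hs⟩ := exists_stalk_hom φ ψ U F hF x hx
  generalize hy : F ⟨x, hx⟩ = y at *
  obtain ⟨V, -, hxV, hV, hVG⟩ := exists_good (k := k) Y n ⊤ y trivial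
  have hxV' : F ⟨x, hx⟩ ∈ V := hy ▸ hxV
  obtain ⟨W, hxW, r, b, -, hW, hr, hb, -⟩ := local_coeff φ hφ ψ hψ ω η ΩX ΩY hX0 hX hY U F hF x hx V hV hxV' ⊤ trivial
  have hbc : (secK φ W (generic_mem W x hxW)).hom b = c := by
    rw [hc] at hb
    exact (smul_cancel_ext (K := K) hX0 hb).symm
  have hxb : x ∈ X.basicOpen b := by
    rw [Scheme.mem_basicOpen _ _ _ hxW]
    obtain ⟨t, ht⟩ := hcinv
    refine IsUnit.of_mul_eq_one (s.hom t) ?_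
    apply toK_injective φ x
    rw [map_mul, map_one]
    have e1 : (toK φ x).hom (X.presheaf.germ W x hxW b) = c := by
      rw [← hbc, secK_germ φ W _ x hxW]; rfl
    have e2 : (toK φ x).hom (s.hom t) = c⁻¹ := by
      rw [← ht, ← hs]; rfl
    rw [e1, e2]
    exact mul_inv_cancel₀ hc0
  obtain ⟨W', hxW', r', b', hW'O, hW', hr', hb', hflat⟩ := local_coeff φ hφ ψ hψ ω η ΩX ΩY hX0 hX hY
    U F hF x hx V hV hxV' (X.basicOpen b) hxb
  have hb'c : (secK φ W' (generic_mem W' x hxW')).hom b' = c := by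
    rw [hc] at hb'
    exact (smul_cancel_ext (K := K) hX0 hb').symm
  have hle : W' ≤ W := hW'O.trans (X.basicOpen_le b)
  have hbb : b' = (X.presheaf.map (homOfLE hle).op).hom b := by
    apply secK_injective φ W' (generic_mem W' x hxW') hW'
    rw [hb'c, ← hbc, ← secK_res φ hle (generic_mem W' x hxW')]; rfl
  have hu : IsUnit b' := by
    have h1 := RingedSpace.isUnit_res_basicOpen X.toRingedSpace b
    have h2 := h1.map (X.presheaf.map (homOfLE hW'O).op).hom
    rw [hbb]
    convert h2 using 1
    have h3 : X.presheaf.map (homOfLE hle).op = X.presheaf.map (homOfLE (X.basicOpen_le b)).op ≫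
      X.presheaf.map (homOfLE hW'O).op := by rw [← Functor.map_comp]; rfl
    rw [h3]; rfl
  have hfl := hflat hVG hu
  let _ : Algebra Γ(Y, V) Γ(X, W') := r'.hom.toAlgebra
  let _ : Algebra Γ(Y, V) (Y.presheaf.stalk y) := (Y.presheaf.germ V y hxV).hom.toAlgebra
  let _ : Algebra Γ(X, W') (X.presheaf.stalk x) := (X.presheaf.germ W' x hxW').hom.toAlgebra
  let _ : Algebra (Y.presheaf.stalk y) (X.presheaf.stalk x) := s.hom.toAlgebra
  let _ : Algebra Γ(Y, V) (X.presheaf.stalk x) := (r' ≫ X.presheaf.germ W' x hxW').hom.toAlgebra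
  have hcomp : Y.presheaf.germ V y hxV ≫ s = r' ≫ X.presheaf.germ W' x hxW' := by
    ext t
    apply toK_injective φ x
    have e1 : (Y.presheaf.germ V y hxV ≫ s) ≫ toK φ x = (r' ≫ X.presheaf.germ W' x hxW') ≫ toK φ x := by
      rw [Category.assoc, hs, ← secK_germ ψ V (generic_mem V _ hxV) y hxV, Category.assoc,
        ← secK_germ φ W' (generic_mem W' _ hxW') x hxW', hr']
    exact congrArg (fun f => f.hom t) e1
  have : IsScalarTower Γ(Y, V) (Y.presheaf.stalk y) (X.presheaf.stalk x) :=
    IsScalarTower.of_algebraMap_eq' (congrArg CommRingCat.Hom.hom hcomp.symm)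
  have : IsScalarTower Γ(Y, V) Γ(X, W') (X.presheaf.stalk x) :=
    IsScalarTower.of_algebraMap_eq' rfl
  have hlocX : IsLocalization.AtPrime (X.presheaf.stalk x) (hW'.primeIdealOf ⟨x, hxW'⟩).asIdeal :=
    hW'.isLocalization_stalk ⟨x, hxW'⟩
  have hlocY : IsLocalization.AtPrime (Y.presheaf.stalk y) (hV.primeIdealOf ⟨y, hxV⟩).asIdeal :=
    hV.isLocalization_stalk ⟨y, hxV⟩
  have f1 : Module.Flat Γ(Y, V) Γ(X, W') := hfl
  have f2 : Module.Flat Γ(X, W') (X.presheaf.stalk x) :=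
    IsLocalization.flat _ (hW'.primeIdealOf ⟨x, hxW'⟩).asIdeal.primeCompl
  have f3 : Module.Flat Γ(Y, V) (X.presheaf.stalk x) := Module.Flat.trans Γ(Y, V) Γ(X, W') _
  have f4 : Module.Flat (Y.presheaf.stalk y) (X.presheaf.stalk x) :=
    (Module.flat_iff_of_isLocalization (Y.presheaf.stalk y)
      (hV.primeIdealOf ⟨y, hxV⟩).asIdeal.primeCompl (X.presheaf.stalk x)).mpr f3
  let _ := (toK φ x).hom.toAlgebra
  let _ := (toK ψ y).hom.toAlgebra
  have : IsScalarTower (Y.presheaf.stalk y) (X.presheaf.stalk x) K :=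
    IsScalarTower.of_algebraMap_eq' (congrArg CommRingCat.Hom.hom hs.symm)
  have := toK_isFractionRing ψ y
  have : IsLocalHom (algebraMap (Y.presheaf.stalk y) (X.presheaf.stalk x)) := hsloc
  have hbij : Function.Bijective s.hom :=
    bijective_of_flat_birational (R := Y.presheaf.stalk y) (S := X.presheaf.stalk x) (K := K)
      (toK_injective φ x)
  have hiso : IsIso s := (ConcreteCategory.isIso_iff_bijective s).mpr hbij
  refine ⟨Spec.map (inv s) ≫ X.fromSpecStalk x, ?_⟩
  rw [← Category.assoc, ← Spec.map_comp, ← hs, IsIso.inv_hom_id_assoc, toK_comp]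

end loc
end BirProof

namespace BirProof
section fin
open AlgebraicGeometry (IsIntegral)

theorem exists_gpt_of_openImmersion {T X : Scheme.{0}} [IsIntegral T] [IsIntegral X] {K : Type} [Field K]
    (φ₀ : T.functionField ≅ CommRingCat.of K) (i : T ⟶ X) [IsOpenImmersion i] :
    ∃ φ : X.functionField ≅ CommRingCat.of K, gpt φ = gpt φ₀ ≫ i := by
  have h : i (genericPoint T) = genericPoint X := genericPoint_eq_of_isOpenImmersion i
  refine ⟨X.presheaf.stalkCongr (.of_eq h.symm) ≪≫ asIso (i.stalkMap (genericPoint T)) ≪≫ φ₀, ?_⟩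
  have h1 : Spec.map (X.presheaf.stalkCongr (.of_eq h.symm)).hom ≫
      X.fromSpecStalk (genericPoint X) = X.fromSpecStalk (i (genericPoint T)) :=
    Scheme.SpecMap_stalkSpecializes_fromSpecStalk (specializes_of_eq h)
  have h1 : Spec.map (X.presheaf.stalkCongr (.of_eq h.symm)).hom ≫
      X.fromSpecStalk (genericPoint X) = X.fromSpecStalk (i (genericPoint T)) :=
    Scheme.SpecMap_stalkSpecializes_fromSpecStalk (specializes_of_eq h)
  have h1 : Spec.map (X.presheaf.stalkCongr (.of_eq h.symm)).hom ≫
      X.fromSpecStalk (genericPoint X) = X.fromSpecStalk (i (genericPoint T)) :=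
    Scheme.SpecMap_stalkSpecializes_fromSpecStalk (specializes_of_eq h)
  simp only [gpt, Iso.trans_hom, asIso_hom, Spec.map_comp, Category.assoc]
  rw [h1, Scheme.SpecMap_stalkMap_fromSpecStalk]

variable {X Y : Scheme.{0}} [IsIntegral X] [IsIntegral Y] {K : Type} [Field K]
variable {k : Type} [Field k] [Algebra k K]
variable [X.Over (Spec (CommRingCat.of k))] [Y.Over (Spec (CommRingCat.of k))]

theorem codim_one_mem (hYproj : IsProjectiveComplexVariety Y)
    [Smooth (X ↘ Spec (CommRingCat.of k))]
    (φ : X.functionField ≅ CommRingCat.of K) (ψ : Y.functionField ≅ CommRingCat.of K)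
    (U : X.Opens) (hU : ∀ x (p : Spec (X.presheaf.stalk x) ⟶ Y), Spec.map (toK φ x) ≫ p = gpt ψ → x ∈ U)
    (x : X) (hx : x ≠ genericPoint X) (h : ∀ y : X, y ⤳ x → y ≠ x → y = genericPoint X) : x ∈ U := by
  have := stalk_dvr (k := k) X x hx h
  obtain ⟨p, hp⟩ := proper_stalk φ hYproj x (gpt ψ)
  exact hU x p hp

theorem codim_two (U : X.Opens) (hgen : genericPoint X ∈ U)
    (h : ∀ x : X, x ≠ genericPoint X → (∀ y : X, y ⤳ x → y ≠ x → y = genericPoint X) → x ∈ U) :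
    codimAtLeastTwo X ((U : Set X)ᶜ) := by
  intro z hz
  have hz0 : z ≠ genericPoint X := by rintro rfl; exact hz hgen
  have h1 : ¬ ∀ y : X, y ⤳ z → y ≠ z → y = genericPoint X := fun h2 => hz (h z hz0 h2)
  push Not at h1
  obtain ⟨y, hyz, hne, hg⟩ := h1
  exact ⟨y, genericPoint X, hne, hg.symm, hyz.mem_closure, (genericPoint_specializes y).mem_closure⟩

theorem forms_const (φ : X.functionField ≅ CommRingCat.of K)
    (hφ : gpt φ ≫ (X ↘ Spec (CommRingCat.of k)) = Spec.map (CommRingCat.ofHom (algebraMap k K)))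
    {n : ℕ} (ω : GaugeForm (CommRingCat.of k) X n)
    [SmoothOfRelativeDimension n (X ↘ Spec (CommRingCat.of k))] :
    ∃ Ω₀ : ExteriorAlgebra K (Ω[K⁄(CommRingCat.of k)]), Ω₀ ≠ 0 ∧
      ∀ W h hW, omK φ hφ W h (ω.form W hW) = Ω₀ := by
  obtain ⟨W, -, hW, hWa, hG⟩ := exists_good (k := k) X n ⊤ (genericPoint X) trivial
  exact ⟨omK φ hφ W hW (ω.form W hWa), omK_ne_zero φ hφ ω W hWa hG hW,
    fun V h hV => omK_eq φ hφ ω W V hWa hV h hW⟩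

theorem maps_into (hXproj : IsProjectiveComplexVariety X)
    (φ : X.functionField ≅ CommRingCat.of K)
    (hφ : gpt φ ≫ (X ↘ Spec (CommRingCat.of k)) = Spec.map (CommRingCat.ofHom (algebraMap k K)))
    (ψ : Y.functionField ≅ CommRingCat.of K)
    (hψ : gpt ψ ≫ (Y ↘ Spec (CommRingCat.of k)) = Spec.map (CommRingCat.ofHom (algebraMap k K)))
    {n : ℕ} (ω : GaugeForm (CommRingCat.of k) X n) (η : GaugeForm (CommRingCat.of k) Y n)
    [SmoothOfRelativeDimension n (X ↘ Spec (CommRingCat.of k))]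
    [SmoothOfRelativeDimension n (Y ↘ Spec (CommRingCat.of k))]
    (U : X.Opens) (F : U.toScheme ⟶ Y) (hgU : genericPoint X ∈ U)
    (hF : ∀ g : Spec (.of K) ⟶ U.toScheme, g ≫ U.ι = gpt φ → g ≫ F = gpt ψ)
    (V : Y.Opens) (G : V.toScheme ⟶ X)
    (hG : ∀ g : Spec (.of K) ⟶ V.toScheme, g ≫ V.ι = gpt ψ → g ≫ G = gpt φ)
    (hV : ∀ y (p : Spec (Y.presheaf.stalk y) ⟶ X), Spec.map (toK ψ y) ≫ p = gpt φ → y ∈ V)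
    (x : X) (hx : x ∈ U) : F ⟨x, hx⟩ ∈ V := by
  obtain ⟨ΩX, hX0, hX⟩ := forms_const φ hφ ω
  obtain ⟨ΩY, hY0, hY⟩ := forms_const ψ hψ η
  have hsY := SmoothOfRelativeDimension.smooth n (Y ↘ Spec (CommRingCat.of k))
  obtain ⟨c, hc⟩ : ∃ c : K, ΩY = c • ΩX := by
    obtain ⟨T, -, hxT, hT, -⟩ := exists_good (k := k) Y n ⊤ (F ⟨x, hx⟩) trivial
    obtain ⟨W, hxW, r, b, -, -, -, hb, -⟩ :=
      local_coeff φ hφ ψ hψ ω η ΩX ΩY hX0 hX hY U F hF x hx T hT hxT ⊤ trivial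
    exact ⟨_, hb⟩
  have hc0 : c ≠ 0 := by
    rintro rfl
    exact hY0 (hc.trans (zero_smul K ΩX))
  have hc' : ΩX = c⁻¹ • ΩY := by
    rw [hc]; exact (inv_smul_smul₀ hc0 ΩX).symm
  have hall : ∀ y : Y, c⁻¹ ∈ (toK ψ y).hom.range := by
    intro y
    refine mem_stalk_of_codim_one (k := k) Y ψ c⁻¹ y ?_
    intro z _ hz0 hz
    exact coeff_mem ψ hψ φ hφ η ω ΩY ΩX hY0 hY hX c⁻¹ hc' V G hG z
      (codim_one_mem (k := k) hXproj ψ φ V hV z hz0 hz)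
  obtain ⟨q, hq⟩ := exists_inverse_local φ hφ ψ hψ ω η ΩX ΩY hX0 hX hY c hc0 hc U F hF x hx (hall _)
  exact hV _ q hq

theorem dense_of_generic (U : X.Opens) (h : genericPoint X ∈ U) : Dense (U : Set X) :=
  fun z => closure_mono (by rintro _ rfl; exact h) (genericPoint_specializes z).mem_closure

theorem main_abs (hXproj : IsProjectiveComplexVariety X) (hYproj : IsProjectiveComplexVariety Y)
    (φ : X.functionField ≅ CommRingCat.of K)
    (hφ : gpt φ ≫ (X ↘ Spec (CommRingCat.of k)) = Spec.map (CommRingCat.ofHom (algebraMap k K)))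
    (ψ : Y.functionField ≅ CommRingCat.of K)
    (hψ : gpt ψ ≫ (Y ↘ Spec (CommRingCat.of k)) = Spec.map (CommRingCat.ofHom (algebraMap k K)))
    {n : ℕ} (ω : GaugeForm (CommRingCat.of k) X n) (η : GaugeForm (CommRingCat.of k) Y n)
    [SmoothOfRelativeDimension n (X ↘ Spec (CommRingCat.of k))]
    [SmoothOfRelativeDimension n (Y ↘ Spec (CommRingCat.of k))] :
    ∃ (U : X.Opens) (V : Y.Opens), Dense (U : Set X) ∧ Dense (V : Set Y) ∧
      (∃ e : U.toScheme ≅ V.toScheme,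
        e.hom ≫ V.ι ≫ (Y ↘ Spec (CommRingCat.of k)) = U.ι ≫ (X ↘ Spec (CommRingCat.of k))) ∧
      codimAtLeastTwo X ((U : Set X)ᶜ) ∧ codimAtLeastTwo Y ((V : Set Y)ᶜ) := by
  have hsX := SmoothOfRelativeDimension.smooth n (X ↘ Spec (CommRingCat.of k))
  have hsY := SmoothOfRelativeDimension.smooth n (Y ↘ Spec (CommRingCat.of k))
  have hsepX := isSeparated_of_proj hXproj
  have hsepY := isSeparated_of_proj hYproj
  obtain ⟨U, F, hgU, hFo, hF, hU⟩ := exists_max φ ψ (X ↘ Spec (CommRingCat.of k))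
    (Y ↘ Spec (CommRingCat.of k)) (hφ.trans hψ.symm)
  obtain ⟨V, G, hgV, hGo, hG, hV⟩ := exists_max ψ φ (Y ↘ Spec (CommRingCat.of k))
    (X ↘ Spec (CommRingCat.of k)) (hψ.trans hφ.symm)
  have hFV : ∀ x : U.toScheme, F x ∈ V := fun x =>
    maps_into hXproj φ hφ ψ hψ ω η U F hgU hF V G hG hV x.1 x.2
  have hGU : ∀ y : V.toScheme, G y ∈ U := fun y =>
    maps_into hYproj ψ hψ φ hφ η ω V G hgV hG U F hF hU y.1 y.2
  have hFr : Set.range F ⊆ Set.range V.ι := by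
    rintro _ ⟨x, rfl⟩; simpa using hFV x
  have hGr : Set.range G ⊆ Set.range U.ι := by
    rintro _ ⟨x, rfl⟩; simpa using hGU x
  let F' := IsOpenImmersion.lift V.ι F hFr
  let G' := IsOpenImmersion.lift U.ι G hGr
  have hF' : F' ≫ V.ι = F := IsOpenImmersion.lift_fac _ _ _
  have hG' : G' ≫ U.ι = G := IsOpenImmersion.lift_fac _ _ _
  obtain ⟨g, hg⟩ := exists_lift φ U hgU
  obtain ⟨g', hg'⟩ := exists_lift ψ V hgV
  have e1 : F' ≫ G' = 𝟙 _ := by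
    rw [← cancel_mono U.ι]
    refine ext_gpt φ U g hg _ _ ?_
    rw [Category.assoc, hG', Category.id_comp, hg, ← Category.assoc]
    exact hG _ (by rw [Category.assoc, hF', hF g hg])
  have e2 : G' ≫ F' = 𝟙 _ := by
    rw [← cancel_mono V.ι]
    refine ext_gpt ψ V g' hg' _ _ ?_
    rw [Category.assoc, hF', Category.id_comp, hg', ← Category.assoc]
    exact hF _ (by rw [Category.assoc, hG', hG g' hg'])
  refine ⟨U, V, dense_of_generic U hgU, dense_of_generic V hgV, ⟨⟨F', G', e1, e2⟩, ?_⟩, ?_, ?_⟩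
  · rw [← Category.assoc]
    change (F' ≫ V.ι) ≫ _ = _
    rw [hF', hFo]
  · exact codim_two U hgU (codim_one_mem (k := k) hYproj φ ψ U hU)
  · exact codim_two V hgV (codim_one_mem (k := k) hXproj ψ φ V hV)

end fin
end BirProof

local notation "ℂRing" => CommRingCat.of ℂ

theorem birational_trivial_canonical_iso_in_codimension_one
    (n : ℕ) (X Y : Scheme.{0})
    [X.Over (Spec ℂRing)] [Y.Over (Spec ℂRing)]
    [IsIntegral X] [IsIntegral Y]
    [SmoothOfRelativeDimension n (X ↘ Spec ℂRing)]
    [SmoothOfRelativeDimension n (Y ↘ Spec ℂRing)]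
    (hXproj : IsProjectiveComplexVariety X) (hYproj : IsProjectiveComplexVariety Y)
    (hKX : Nonempty (GaugeForm ℂRing X n)) (hKY : Nonempty (GaugeForm ℂRing Y n))
    (hbir : ∃ (U : X.Opens) (V : Y.Opens), Dense (U : Set X) ∧ Dense (V : Set Y) ∧
      ∃ e : U.toScheme ≅ V.toScheme,
        e.hom ≫ V.ι ≫ (Y ↘ Spec ℂRing) = U.ι ≫ (X ↘ Spec ℂRing)) :
    ∃ (U : X.Opens) (V : Y.Opens), Dense (U : Set X) ∧ Dense (V : Set Y) ∧
      (∃ e : U.toScheme ≅ V.toScheme,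
        e.hom ≫ V.ι ≫ (Y ↘ Spec ℂRing) = U.ι ≫ (X ↘ Spec ℂRing)) ∧
      codimAtLeastTwo X ((U : Set X)ᶜ) ∧ codimAtLeastTwo Y ((V : Set Y)ᶜ) := by
  obtain ⟨ω⟩ := hKX
  obtain ⟨η⟩ := hKY
  obtain ⟨U, V, hU, hV, e, he⟩ := hbir
  have hne : Nonempty U.toScheme := by
    obtain ⟨x, hx⟩ := hU.nonempty
    exact ⟨⟨x, hx⟩⟩
  have hInt : IsIntegral U.toScheme := inferInstance
  let φ₀ : U.toScheme.functionField ≅ CommRingCat.of U.toScheme.functionField := Iso.refl _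
  obtain ⟨φ, hφ⟩ := BirProof.exists_gpt_of_openImmersion φ₀ U.ι
  obtain ⟨ψ, hψ⟩ := BirProof.exists_gpt_of_openImmersion φ₀ (e.hom ≫ V.ι)
  let σ := Spec.preimage (BirProof.gpt φ ≫ (X ↘ Spec ℂRing))
  let _ : Algebra ℂ U.toScheme.functionField := σ.hom.toAlgebra
  refine BirProof.main_abs (k := ℂ) (K := U.toScheme.functionField) hXproj hYproj φ ?_ ψ ?_ ω η
  · exact (Spec.map_preimage _).symm
  · refine Eq.trans ?_ (Spec.map_preimage (BirProof.gpt φ ≫ (X ↘ Spec ℂRing))).symm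
    rw [hφ, hψ, Category.assoc, Category.assoc, Category.assoc, he]
end

section
/- Let q > 1 be a real number, n a positive integer, and let P_0,…,P_{2n} and Q_0,…,Q_{2n} be polynomials with complex coefficients such that P_i(0) = Q_i(0) = 1 for all i, every complex root of P_i and of Q_i has absolute value q^{-i/2}, and the rational functions (P_1·P_3···P_{2n-1})/(P_0·P_2···P_{2n}) and (Q_1·Q_3···Q_{2n-1})/(Q_0·Q_2···Q_{2n}) are equal. Then P_i = Q_i for all i = 0,…,2n; in particular, deg P_i = deg Q_i for all i. -/
/-!
STATEMENT 11: Let q > 1 be a real number, n a positive integer, and let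
P_0,…,P_{2n} and Q_0,…,Q_{2n} be polynomials with complex coefficients such that
P_i(0) = Q_i(0) = 1 for all i, every complex root of P_i and of Q_i has absolute
value q^{-i/2}, and the rational functions
(P_1·P_3···P_{2n-1})/(P_0·P_2···P_{2n}) and (Q_1·Q_3···Q_{2n-1})/(Q_0·Q_2···Q_{2n})
are equal (i.e. cross-multiplication gives equal polynomials).
Then P_i = Q_i for all i = 0,…,2n; in particular deg P_i = deg Q_i for all i.
-/

open Polynomial

lemma rootMult_prod_aux (z : ℂ) (s : Finset ℕ) (f : ℕ → Polynomial ℂ) (h : ∀ i ∈ s, f i ≠ 0) :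
    (∏ j ∈ s, f j).rootMultiplicity z = ∑ j ∈ s, (f j).rootMultiplicity z := by
  induction s using Finset.induction_on with
  | empty =>
    simp only [Finset.prod_empty, Finset.sum_empty]
    exact rootMultiplicity_eq_zero (by simp [IsRoot])
  | insert a s ha ih =>
    have h1 : f a ≠ 0 := h a (Finset.mem_insert_self _ _)
    have h2 : ∀ i ∈ s, f i ≠ 0 := fun i hi => h i (Finset.mem_insert_of_mem hi)
    rw [Finset.prod_insert ha, Finset.sum_insert ha,
      rootMultiplicity_mul (mul_ne_zero h1 (Finset.prod_ne_zero_iff.mpr h2)), ih h2]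

lemma eq_of_roots_aux (p r : Polynomial ℂ) (hp : p.eval 0 = 1) (hr : r.eval 0 = 1)
    (h : p.roots = r.roots) : p = r := by
  have e1 := (IsAlgClosed.splits p).eq_prod_roots
  have e2 := (IsAlgClosed.splits r).eq_prod_roots
  rw [← h] at e2
  set m := (p.roots.map fun a => X - C a).prod with hm
  have h1 : p.leadingCoeff * m.eval 0 = 1 := by
    rw [← hp]; conv_rhs => rw [e1]
    simp
  have h2 : r.leadingCoeff * m.eval 0 = 1 := by
    rw [← hr]; conv_rhs => rw [e2]
    simp
  have hm0 : m.eval 0 ≠ 0 := right_ne_zero_of_mul_eq_one h1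
  have : p.leadingCoeff = r.leadingCoeff := mul_right_cancel₀ hm0 (h1.trans h2.symm)
  rw [e1, e2, this]

lemma parity_sum_aux (n i : ℕ) (hi : i ≤ 2 * n) (f g : ℕ → ℕ)
    (hf : ∀ k ≤ 2 * n, k ≠ i → f k = 0) (hg : ∀ k ≤ 2 * n, k ≠ i → g k = 0)
    (h : ∑ j ∈ Finset.range n, f (2 * j + 1) + ∑ j ∈ Finset.range (n + 1), g (2 * j) =
      ∑ j ∈ Finset.range n, g (2 * j + 1) + ∑ j ∈ Finset.range (n + 1), f (2 * j)) :
    f i = g i := by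
  rcases Nat.even_or_odd' i with ⟨m, rfl | rfl⟩
  · have o : ∀ u : ℕ → ℕ, (∀ k ≤ 2 * n, k ≠ 2 * m → u k = 0) →
        ∑ j ∈ Finset.range n, u (2 * j + 1) = 0 ∧
        ∑ j ∈ Finset.range (n + 1), u (2 * j) = u (2 * m) := by
      intro u hu
      refine ⟨Finset.sum_eq_zero fun j hj => ?_, Finset.sum_eq_single m (fun j hj hne => ?_) ?_⟩
      · have := Finset.mem_range.mp hj
        exact hu _ (by omega) (by omega)
      · have := Finset.mem_range.mp hj
        exact hu _ (by omega) (by omega)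
      · intro hm
        exact absurd (Finset.mem_range.mpr (by omega)) hm
    have := o f hf
    have := o g hg
    omega
  · have o : ∀ u : ℕ → ℕ, (∀ k ≤ 2 * n, k ≠ 2 * m + 1 → u k = 0) →
        ∑ j ∈ Finset.range n, u (2 * j + 1) = u (2 * m + 1) ∧
        ∑ j ∈ Finset.range (n + 1), u (2 * j) = 0 := by
      intro u hu
      refine ⟨Finset.sum_eq_single m (fun j hj hne => ?_) ?_, Finset.sum_eq_zero fun j hj => ?_⟩
      · have := Finset.mem_range.mp hj
        exact hu _ (by omega) (by omega)
      · intro hm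
        exact absurd (Finset.mem_range.mpr (by omega)) hm
      · have := Finset.mem_range.mp hj
        exact hu _ (by omega) (by omega)
    have := o f hf
    have := o g hg
    omega

theorem weil_polynomials_determined_by_zeta
    (q : ℝ) (hq : 1 < q) (n : ℕ) (hn : 0 < n)
    (P Q : ℕ → Polynomial ℂ)
    (hP0 : ∀ i ≤ 2 * n, (P i).eval 0 = 1)
    (hQ0 : ∀ i ≤ 2 * n, (Q i).eval 0 = 1)
    (hProots : ∀ i ≤ 2 * n, ∀ z : ℂ, (P i).IsRoot z →
      ‖z‖ = q ^ (-(i : ℝ) / 2))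
    (hQroots : ∀ i ≤ 2 * n, ∀ z : ℂ, (Q i).IsRoot z →
      ‖z‖ = q ^ (-(i : ℝ) / 2))
    (heq : (∏ j ∈ Finset.range n, P (2 * j + 1)) *
             (∏ j ∈ Finset.range (n + 1), Q (2 * j)) =
           (∏ j ∈ Finset.range n, Q (2 * j + 1)) *
             (∏ j ∈ Finset.range (n + 1), P (2 * j))) :
    (∀ i ≤ 2 * n, P i = Q i) ∧ ∀ i ≤ 2 * n, (P i).degree = (Q i).degree := by
  have hPn : ∀ i ≤ 2 * n, P i ≠ 0 := fun i hi h => by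
    have := hP0 i hi
    simp [h] at this
  have hQn : ∀ i ≤ 2 * n, Q i ≠ 0 := fun i hi h => by
    have := hQ0 i hi
    simp [h] at this
  have inj : ∀ i k : ℕ, q ^ (-(i : ℝ) / 2) = q ^ (-(k : ℝ) / 2) → i = k := by
    intro i k h
    have h1 := (Real.strictMono_rpow_of_base_gt_one hq).injective h
    have h2 : (i : ℝ) = k := by linarith
    exact_mod_cast h2
  have odd_ne : ∀ R : ℕ → Polynomial ℂ, (∀ i ≤ 2 * n, R i ≠ 0) →
      ∀ j ∈ Finset.range n, R (2 * j + 1) ≠ 0 := fun R hR j hj => by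
    have := Finset.mem_range.mp hj
    exact hR _ (by omega)
  have even_ne : ∀ R : ℕ → Polynomial ℂ, (∀ i ≤ 2 * n, R i ≠ 0) →
      ∀ j ∈ Finset.range (n + 1), R (2 * j) ≠ 0 := fun R hR j hj => by
    have := Finset.mem_range.mp hj
    exact hR _ (by omega)
  have main : ∀ i ≤ 2 * n, P i = Q i := by
    intro i hi
    refine eq_of_roots_aux _ _ (hP0 i hi) (hQ0 i hi) ?_
    ext z
    rw [count_roots, count_roots]
    by_cases hz : ‖z‖ = q ^ (-(i : ℝ) / 2)
    · refine parity_sum_aux n i hi (fun k => (P k).rootMultiplicity z)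
        (fun k => (Q k).rootMultiplicity z) ?_ ?_ ?_
      · intro k hk hne
        exact rootMultiplicity_eq_zero fun hr => hne (inj k i ((hProots k hk z hr).symm.trans hz))
      · intro k hk hne
        exact rootMultiplicity_eq_zero fun hr => hne (inj k i ((hQroots k hk z hr).symm.trans hz))
      · have h := congrArg (rootMultiplicity z) heq
        rw [rootMultiplicity_mul (mul_ne_zero (Finset.prod_ne_zero_iff.mpr (odd_ne P hPn))
            (Finset.prod_ne_zero_iff.mpr (even_ne Q hQn))),
          rootMultiplicity_mul (mul_ne_zero (Finset.prod_ne_zero_iff.mpr (odd_ne Q hQn))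
            (Finset.prod_ne_zero_iff.mpr (even_ne P hPn))),
          rootMult_prod_aux z _ (fun j => P (2 * j + 1)) (odd_ne P hPn),
          rootMult_prod_aux z _ (fun j => Q (2 * j + 1)) (odd_ne Q hQn),
          rootMult_prod_aux z _ (fun j => P (2 * j)) (even_ne P hPn),
          rootMult_prod_aux z _ (fun j => Q (2 * j)) (even_ne Q hQn)] at h
        exact h
    · rw [rootMultiplicity_eq_zero fun hr => hz (hProots i hi z hr),
        rootMultiplicity_eq_zero fun hr => hz (hQroots i hi z hr)]
  exact ⟨main, fun i hi => by rw [main i hi]⟩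
end
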